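/- arXiv:1105.6224 — 5 statements merged into one kernel-verified Lean document; each statement's English description precedes it below -/
import Mathlib

section
/- Let q be a prime power and let C ⊆ F_q^n be a code with the expander-code structure determined by parameters Δ1, k1, b1 (n = b1Δ1, R1 = k1/Δ1), block matrices H_1,…,H_{b1} of full row rank and an arbitrary matrix B. Set R = dim(C)/n. Then for every integer b' satisfying ((R1−R)/R1)·b1 + 1/(R1Δ1) ≤ b' ≤ b1, the integer k̃ = b'·R1Δ1 − (R1−R)n satisfies k̃ ≥ 1, the code C contains a nonzero codeword, and its minimum distance satisfies d(C) ≤ (q^{k̃−1}(q−1)/(q^{k̃}−1)) · b'Δ1. -/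
lemma aux_coord {F : Type} [Field F] [Fintype F] [DecidableEq F] {V : Type} [AddCommGroup V] [Module F V]
    [Fintype V] (k : ℕ) (hk : Module.finrank F V = k + 1) (f : V →ₗ[F] F) :
    (Finset.univ.filter (fun x => f x ≠ 0)).card ≤ Fintype.card F ^ (k+1) - Fintype.card F ^ k := by
  classical
  by_cases hf : f = 0
  · simp [hf]
  have hs : Function.Surjective f := LinearMap.surjective hf
  have h1 := LinearMap.finrank_range_add_finrank_ker f
  rw [LinearMap.range_eq_top.2 hs, finrank_top, Module.finrank_self, hk] at h1
  have h2 : Fintype.card (LinearMap.ker f) = Fintype.card F ^ k := by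
    rw [Module.card_eq_pow_finrank (K := F)]; congr 1; omega
  have h3 : Fintype.card V = Fintype.card F ^ (k+1) := by
    rw [Module.card_eq_pow_finrank (K := F), hk]
  have h4 : (Finset.univ.filter (fun x => f x = 0)).card = Fintype.card F ^ k := by
    rw [← h2, Fintype.card_subtype]; simp
  have h5 := Finset.card_filter_add_card_filter_not (s := (Finset.univ : Finset V)) (fun x => f x = 0)
  rw [Finset.card_univ, h3, h4] at h5
  simp only [ne_eq]
  omega

lemma aux_plotkin {F ι : Type} [Field F] [Fintype F] [DecidableEq F] [Fintype ι] [DecidableEq ι]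
    (D : Submodule F (ι → F)) (k : ℕ) (hk : Module.finrank F D = k + 1) (S : Finset ι)
    (hS : ∀ x ∈ D, ∀ i, i ∉ S → x i = 0) :
    ∃ c ∈ D, c ≠ 0 ∧ hammingNorm c * (Fintype.card F ^ (k+1) - 1) ≤
      S.card * (Fintype.card F ^ (k+1) - Fintype.card F ^ k) := by
  classical
  have hq : 1 < Fintype.card F := Fintype.one_lt_card
  have h3 : Fintype.card D = Fintype.card F ^ (k+1) := by
    rw [Module.card_eq_pow_finrank (K := F), hk]
  have hpos : 1 < Fintype.card D := by rw [h3]; exact Nat.one_lt_pow (by omega) hq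
  have hw : ∀ x : D, hammingNorm (x : ι → F) = ∑ i ∈ S, if (x : ι → F) i ≠ 0 then 1 else 0 := by
    intro x
    rw [hammingNorm, ← Finset.card_filter]
    congr 1
    ext i
    simp only [Finset.mem_filter, Finset.mem_univ, true_and]
    constructor
    · intro h; exact ⟨by by_contra h'; exact h (hS x x.2 i h'), h⟩
    · exact fun h => h.2
  have hsum : ∑ x : D, hammingNorm (x : ι → F) ≤
      S.card * (Fintype.card F ^ (k+1) - Fintype.card F ^ k) := by
    simp_rw [hw]
    rw [Finset.sum_comm, ← smul_eq_mul]
    apply Finset.sum_le_card_nsmul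
    intro i _
    rw [← Finset.card_filter]
    exact aux_coord k hk ((LinearMap.proj i).comp D.subtype)
  have hne : ((Finset.univ : Finset D).erase 0).Nonempty := by
    rw [← Finset.card_pos, Finset.card_erase_of_mem (Finset.mem_univ _), Finset.card_univ]; omega
  obtain ⟨c, hc, hmin⟩ := Finset.exists_min_image _ (fun x : D => hammingNorm (x : ι → F)) hne
  refine ⟨c, c.2, by simpa using hc, le_trans ?_ hsum⟩
  have h6 := Finset.card_nsmul_le_sum _ (fun x : D => hammingNorm (x : ι → F)) _ hmin
  rw [Finset.card_erase_of_mem (Finset.mem_univ _), Finset.card_univ, h3, smul_eq_mul, mul_comm] at h6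
  exact h6.trans (Finset.sum_le_sum_of_subset (Finset.erase_subset _ _))

lemma aux_exact {F V : Type} [Field F] [AddCommGroup V] [Module F V]
    (W : Submodule F V) (k : ℕ) (h : k ≤ Module.finrank F W) :
    ∃ D : Submodule F V, D ≤ W ∧ Module.finrank F D = k := by
  obtain ⟨f, hf⟩ := exists_linearIndependent_of_le_finrank h
  have hf2 := hf.map' W.subtype (Submodule.ker_subtype _)
  refine ⟨Submodule.span F (Set.range (W.subtype ∘ f)), ?_, ?_⟩
  · rw [Submodule.span_le]
    rintro _ ⟨i, rfl⟩
    exact (f i).2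
  · rw [finrank_span_eq_card hf2, Fintype.card_fin]

lemma aux_sub {F : Type} [Field F] 
    (Δ1 k1 b1 : ℕ) (hk1' : k1 ≤ Δ1)
    (H : Fin b1 → Matrix (Fin (Δ1 - k1)) (Fin Δ1) F)
    (hH : ∀ i, (H i).rank = Δ1 - k1)
    (C : Submodule F (Fin b1 × Fin Δ1 → F))
    (hC : ∀ x ∈ C, (∀ i, (H i).mulVec (fun j => x (i, j)) = 0))
    (b' : ℕ) (hb'u : b' ≤ b1) (k : ℕ) (hk : k + (b1 - b') * k1 = Module.finrank F C) :
    ∃ D : Submodule F (Fin b1 × Fin Δ1 → F), D ≤ C ∧ Module.finrank F D = k ∧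
      ∀ x ∈ D, ∀ i, b' ≤ i.1.1 → x i = 0 := by
  obtain ⟨g, hg⟩ : ∃ g : C →ₗ[F] ((i : {i : Fin b1 // b' ≤ i.1}) → LinearMap.ker (H i.1).mulVecLin),
      ∀ x i j, (g x i).1 j = x.1 (i.1, j) :=
    ⟨LinearMap.pi fun i => LinearMap.codRestrict _
      ((LinearMap.funLeft F F (fun j => (i.1, j))).comp C.subtype) (fun x => hC x x.2 i.1),
      fun x i j => rfl⟩
  have hker : ∀ i, Module.finrank F (LinearMap.ker (H i).mulVecLin) = k1 := by
    intro i
    have h1 := LinearMap.finrank_range_add_finrank_ker (H i).mulVecLin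
    have h2 := hH i
    rw [Matrix.rank] at h2
    rw [h2] at h1
    simp at h1
    omega
  have hcard : Fintype.card {i : Fin b1 // b' ≤ i.1} = b1 - b' := by
    rw [Fintype.card_subtype]
    have h1 := Finset.card_filter_add_card_filter_not (s := (Finset.univ : Finset (Fin b1))) (fun x => b' ≤ x.1)
    have h2 : (Finset.univ.filter (fun x : Fin b1 => x.1 < b')).card = b' := by
      rw [Fin.card_filter_val_lt]; omega
    simp only [not_le, h2, Finset.card_univ, Fintype.card_fin] at h1
    omega
  have h1 := LinearMap.finrank_range_add_finrank_ker g
  have h2 := Submodule.finrank_le (LinearMap.range g)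
  rw [Module.finrank_pi_fintype] at h2
  simp only [hker, Finset.sum_const, Finset.card_univ, hcard, smul_eq_mul] at h2
  have h3 : k ≤ Module.finrank F (LinearMap.ker g) := by omega
  rw [← Submodule.finrank_map_subtype_eq] at h3
  obtain ⟨D, hle, hD⟩ := aux_exact _ k h3
  refine ⟨D, hle.trans (Submodule.map_subtype_le _ _), hD, ?_⟩
  · intro x hx i hi
    obtain ⟨y, hy, rfl⟩ := hle hx
    have h5 := hg y ⟨i.1, hi⟩ i.2
    rw [LinearMap.mem_ker.1 hy] at h5
    exact h5.symm

/-- Let q be a prime power and let C ⊆ F_q^n be a code with the expander-code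
structure determined by parameters Δ1, k1, b1 (n = b1·Δ1, R1 = k1/Δ1), block matrices
H_1,…,H_{b1} of full row rank (arranged block-diagonally, the i-th block acting on the i-th
group of Δ1 coordinates) and an arbitrary matrix B.  Set R = dim(C)/n.  Then for every integer
b' with ((R1−R)/R1)·b1 + 1/(R1·Δ1) ≤ b' ≤ b1, the integer k̃ = b'·R1·Δ1 − (R1−R)·n satisfies
k̃ ≥ 1, C contains a nonzero codeword, and d(C) ≤ (q^{k̃−1}(q−1)/(q^{k̃}−1))·b'·Δ1. -/
theorem statement_0 (q : ℕ) (hq : IsPrimePow q)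
    (F : Type) [Field F] [Fintype F] [DecidableEq F] (hF : Fintype.card F = q)
    (Δ1 k1 b1 : ℕ) (hΔ1 : 1 ≤ Δ1) (hk1 : 1 ≤ k1) (hk1' : k1 ≤ Δ1) (hb1 : 1 ≤ b1)
    (H : Fin b1 → Matrix (Fin (Δ1 - k1)) (Fin Δ1) F)
    (hH : ∀ i, (H i).rank = Δ1 - k1)
    (m : ℕ) (B : Matrix (Fin m) (Fin b1 × Fin Δ1) F)
    (C : Submodule F (Fin b1 × Fin Δ1 → F))
    (hC : ∀ x, x ∈ C ↔ (∀ i, (H i).mulVec (fun j => x (i, j)) = 0) ∧ B.mulVec x = 0)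
    (n : ℕ) (hn : n = b1 * Δ1)
    (R1 R : ℚ) (hR1 : R1 = (k1 : ℚ) / (Δ1 : ℚ))
    (hR : R = (Module.finrank F C : ℚ) / (n : ℚ))
    (b' : ℕ) (hb'l : ((R1 - R) / R1) * (b1 : ℚ) + 1 / (R1 * (Δ1 : ℚ)) ≤ (b' : ℚ))
    (hb'u : b' ≤ b1)
    (ktilde : ℤ) (hkt : (ktilde : ℚ) = (b' : ℚ) * R1 * (Δ1 : ℚ) - (R1 - R) * (n : ℚ)) :
    1 ≤ ktilde ∧ (∃ c ∈ C, c ≠ 0) ∧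
      ∃ c ∈ C, c ≠ 0 ∧
        (hammingNorm c : ℚ) ≤
          (q : ℚ) ^ (ktilde - 1) * ((q : ℚ) - 1) / ((q : ℚ) ^ ktilde - 1)
            * ((b' : ℚ) * (Δ1 : ℚ)) := by

  have hk0 : (0:ℚ) < k1 := by exact_mod_cast hk1
  have hd0 : (0:ℚ) < Δ1 := by exact_mod_cast hΔ1
  have hb0 : (0:ℚ) < b1 := by exact_mod_cast hb1
  have hn' : (n:ℚ) = b1 * Δ1 := by rw [hn]; push_cast; rfl
  have hR1' : R1 * Δ1 = k1 := by rw [hR1]; field_simp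
  have hR1p : 0 < R1 := by rw [hR1]; positivity
  have hRn : R * n = Module.finrank F C := by
    rw [hR]; have : (n:ℚ) ≠ 0 := by rw [hn']; positivity
    field_simp
  have hkq : (ktilde : ℚ) = b' * k1 - b1 * k1 + Module.finrank F C := by
    rw [hkt, sub_mul, hRn, mul_assoc, hR1', hn', ← hR1']; ring
  have hkz : ktilde = b' * k1 - b1 * k1 + Module.finrank F C := by exact_mod_cast hkq
  have h1 : 1 ≤ ktilde := by
    have h := mul_le_mul_of_nonneg_right hb'l hk0.le
    have e : ((R1 - R) / R1 * (b1:ℚ) + 1 / (R1 * Δ1)) * k1 = (R1 - R) * n + 1 := by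
      rw [hn', ← hR1']; field_simp
    rw [e] at h
    have : (1:ℚ) ≤ ktilde := by
      rw [hkt, mul_assoc, hR1']; linarith
    exact_mod_cast this
  obtain ⟨k, rfl⟩ : ∃ k : ℕ, ktilde = k + 1 := ⟨(ktilde - 1).toNat, by omega⟩
  have hkn : (k + 1) + (b1 - b') * k1 = Module.finrank F C := by
    zify [hb'u]; linarith
  obtain ⟨D, hDC, hDk, hD⟩ := aux_sub Δ1 k1 b1 hk1' H hH C (fun x hx => ((hC x).1 hx).1) b' hb'u (k+1) hkn
  obtain ⟨c, hcD, hc0, hc⟩ := aux_plotkin D k hDk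
    ((Finset.univ.filter (fun x : Fin b1 => x.1 < b')) ×ˢ Finset.univ) (by
      intro x hx i hi
      apply hD x hx
      simpa using hi)
  refine ⟨h1, ⟨c, hDC hcD, hc0⟩, c, hDC hcD, hc0, ?_⟩
  have hq1 : 1 < q := hq.one_lt
  rw [hF, Finset.card_product, Fin.card_filter_val_lt, min_eq_right hb'u, Finset.card_univ, Fintype.card_fin] at hc
  have ha : 1 ≤ q ^ (k+1) := Nat.one_le_pow _ _ (by omega)
  have hb : q ^ k ≤ q ^ (k+1) := Nat.pow_le_pow_right (by omega) (by omega)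
  have hcq : (hammingNorm c : ℚ) * ((q:ℚ) ^ (k+1) - 1) ≤ b' * Δ1 * ((q:ℚ)^(k+1) - (q:ℚ)^k) := by
    have := (Nat.cast_le (α := ℚ)).2 hc
    push_cast [Nat.cast_sub ha, Nat.cast_sub hb] at this
    exact this
  have hp : (0:ℚ) < (q:ℚ) ^ (k+1) - 1 := by
    have : (1:ℚ) < (q:ℚ) ^ (k+1) := one_lt_pow₀ (by exact_mod_cast hq1) (by omega)
    linarith
  have e1 : (q:ℚ) ^ ((k:ℤ) + 1 - 1) = (q:ℚ)^k := by rw [add_sub_cancel_right, zpow_natCast]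
  have e2 : (q:ℚ) ^ ((k:ℤ) + 1) = (q:ℚ)^(k+1) := by exact_mod_cast zpow_natCast (q:ℚ) (k+1)
  rw [e1, e2, div_mul_eq_mul_div, le_div_iff₀ hp]
  refine hcq.trans (le_of_eq ?_)
  ring
end

section
/- Let q be a prime power, let C0 = RS(Δ0,k0) be a Reed–Solomon code over F_q, let b ≥ 1 and n = bΔ0, and consider the two-layer ensemble E1(Δ0,b) with base code C_b = C0^b. Then for every W with 0 ≤ W ≤ n, the ensemble-average number of weight-W codewords satisfies Ā(W) = A(W)² / ((q−1)^W · binom(n,W)), where A(W) = #{y ∈ C_b : wt(y) = W}. -/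
open Finset in
lemma aux_sphere {ι F : Type} [Fintype ι] [DecidableEq ι] [Field F] [Fintype F] [DecidableEq F] (W : ℕ) :
    #{x : ι → F | hammingNorm x = W} = (Fintype.card F - 1) ^ W * (Fintype.card ι).choose W := by
  have h1 : ({x : ι → F | hammingNorm x = W} : Finset (ι → F)) =
      (powersetCard W (univ : Finset ι)).biUnion
        (fun s => Fintype.piFinset (fun i => if i ∈ s then univ.erase (0 : F) else {0})) := by
    ext x
    simp only [mem_filter, mem_univ, true_and, mem_biUnion, mem_powersetCard, Fintype.mem_piFinset, subset_univ]
    constructor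
    · intro h
      refine ⟨Finset.univ.filter (fun i => x i ≠ 0), h, fun i => ?_⟩
      by_cases hi : x i = 0 <;> simp [hi]
    · rintro ⟨s, hs, h⟩
      rw [← hs, hammingNorm]
      congr 1
      ext i
      have := h i
      by_cases hi : i ∈ s <;> simp_all
  rw [h1, card_biUnion]
  · rw [Finset.sum_congr rfl (g := fun _ => (Fintype.card F - 1) ^ W)]
    · simp [mul_comm]
    · intro s hs
      rw [mem_powersetCard] at hs
      rw [Fintype.card_piFinset]
      have : ∀ i, #(if i ∈ s then univ.erase (0 : F) else {0}) =
          if i ∈ s then Fintype.card F - 1 else 1 := by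
        intro i; split_ifs <;> simp [card_erase_of_mem]
      simp [this, hs.2, Finset.prod_ite]
  · intro s _ t _ hst
    rw [Function.onFun, Finset.disjoint_left]
    intro x hx hx'
    apply hst
    ext i
    rw [Fintype.mem_piFinset] at hx hx'
    have h1 := hx i
    have h2 := hx' i
    by_cases hi : i ∈ s <;> by_cases hi' : i ∈ t <;> simp_all

abbrev auxG (ι F : Type) [Field F] := Equiv.Perm ι × {c : ι → F // ∀ j, c j ≠ 0}

def auxAct {ι F : Type} [Field F] (g : auxG ι F) (x : ι → F) : ι → F :=
  fun j => (g.2 : ι → F) j * x (g.1 j)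

lemma aux_cardG {ι F : Type} [Fintype ι] [DecidableEq ι] [Field F] [Fintype F] [DecidableEq F] :
    Fintype.card (auxG ι F) =
      (Fintype.card ι).factorial * (Fintype.card F - 1) ^ (Fintype.card ι) := by
  rw [Fintype.card_prod, Fintype.card_perm,
    Fintype.card_congr (Equiv.subtypePiEquivPi (p := fun (_ : ι) (a : F) => a ≠ 0))]
  simp [Fintype.card_subtype_compl]

lemma aux_inj {ι F : Type} [Field F] (g : auxG ι F) : Function.Injective (auxAct g) := by
  intro x y h
  ext i
  have := congrFun h (g.1.symm i)
  simpa [auxAct, g.2.2] using this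

lemma aux_norm {ι F : Type} [Fintype ι] [DecidableEq ι] [Field F] [DecidableEq F]
    (g : auxG ι F) (x : ι → F) : hammingNorm (auxAct g x) = hammingNorm x := by
  unfold hammingNorm
  apply Finset.card_bij (fun i _ => g.1 i)
  · intro i; simp [auxAct, g.2.2]
  · intro i _ j _ h; simpa using h
  · intro j hj
    exact ⟨g.1.symm j, by simpa [auxAct, g.2.2] using hj, by simp⟩

lemma aux_trans {ι F : Type} [Fintype ι] [DecidableEq ι] [Field F] [DecidableEq F]
    (x y : ι → F) (h : hammingNorm x = hammingNorm y) : ∃ g : auxG ι F, y = auxAct g x := by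
  have hc : Fintype.card {i // y i ≠ 0} = Fintype.card {i // x i ≠ 0} := by
    rw [Fintype.card_subtype, Fintype.card_subtype]; exact h.symm
  let e := Fintype.equivOfCardEq hc
  let p := e.extendSubtype
  have hp : ∀ i, y i ≠ 0 → x (p i) ≠ 0 := fun i hi => e.extendSubtype_mem i hi
  have hp' : ∀ i, ¬ y i ≠ 0 → ¬ x (p i) ≠ 0 := fun i hi => e.extendSubtype_not_mem i hi
  refine ⟨⟨p, fun j => if y j = 0 then 1 else y j / x (p j), fun j => ?_⟩, ?_⟩
  · by_cases hj : y j = 0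
    · simp [hj]
    · simp [hj, hp j hj]
  · ext j
    by_cases hj : y j = 0
    · have := hp' j (by simpa using hj)
      simp only [auxAct, hj, if_true]
      rw [not_not.1 this, mul_zero]
    · simp [auxAct, hj, hp j hj]

open Finset in
open scoped Classical in
lemma aux_le {ι F : Type} [Fintype ι] [DecidableEq ι] [Field F] [Fintype F] [DecidableEq F]
    (C : Set (ι → F)) (x y : ι → F) (h : hammingNorm x = hammingNorm y) :
    #{g : auxG ι F | auxAct g y ∈ C} ≤ #{g : auxG ι F | auxAct g x ∈ C} := by
  obtain ⟨g0, rfl⟩ := aux_trans x y h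
  apply Finset.card_le_card_of_injOn
    (fun g => (⟨g.1.trans g0.1, fun j => g.2.1 j * g0.2.1 (g.1 j),
      fun j => mul_ne_zero (g.2.2 j) (g0.2.2 _)⟩ : auxG ι F))
  · intro g hg
    simp only [coe_filter, mem_univ, true_and, Set.mem_setOf_eq] at hg ⊢
    convert hg using 1
    ext j
    simp [auxAct, mul_assoc]
  · rintro ⟨p, c, hc⟩ _ ⟨p', c', hc'⟩ _ he
    simp only [Prod.mk.injEq, Subtype.mk.injEq] at he
    obtain ⟨h1, h2⟩ := he
    have h3 : p = p' := by
      ext i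
      have := congrArg (fun e : Equiv.Perm ι => e i) h1
      simpa using this
    subst h3
    congr 2
    ext j
    have := congrFun h2 j
    exact mul_right_cancel₀ (g0.2.2 _) this

open Finset in
open scoped Classical in
lemma aux_main {ι F : Type} [Fintype ι] [DecidableEq ι] [Field F] [Fintype F] [DecidableEq F]
    (C : Set (ι → F)) (W : ℕ) (hW : W ≤ Fintype.card ι) :
    (∑ t : auxG ι F × auxG ι F,
      (#{x : ι → F | auxAct t.1 x ∈ C ∧ auxAct t.2 x ∈ C ∧ hammingNorm x = W} : ℚ)) *
      (#{x : ι → F | hammingNorm x = W} : ℚ)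
    = (Fintype.card (auxG ι F) : ℚ) ^ 2 * (#{x : ι → F | x ∈ C ∧ hammingNorm x = W} : ℚ) ^ 2 := by
  set S : Finset (ι → F) := {x : ι → F | hammingNorm x = W} with hS
  let N : (ι → F) → ℕ := fun x => #{g : auxG ι F | auxAct g x ∈ C}
  have hconst : ∀ x ∈ S, ∀ y ∈ S, N x = N y := by
    intro x hx y hy
    simp only [hS, mem_filter, mem_univ, true_and] at hx hy
    exact le_antisymm (aux_le C y x (hy.trans hx.symm)) (aux_le C x y (hx.trans hy.symm))
  have hg : ∀ g : auxG ι F, #{x ∈ S | auxAct g x ∈ C} = #{x : ι → F | x ∈ C ∧ hammingNorm x = W} := by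
    intro g
    apply Finset.card_bij (fun x _ => auxAct g x)
    · intro x hx
      simp only [hS, mem_filter, mem_univ, true_and] at hx ⊢
      exact ⟨hx.2, (aux_norm g x).trans hx.1⟩
    · intro x _ y _ h; exact aux_inj g h
    · intro y hy
      obtain ⟨x, rfl⟩ := (Finite.injective_iff_surjective.1 (aux_inj g)) y
      simp only [hS, mem_filter, mem_univ, true_and, aux_norm] at hy
      exact ⟨x, by simpa [hS] using hy.symm, rfl⟩
  have h1 : ∑ x ∈ S, N x = Fintype.card (auxG ι F) * #{x : ι → F | x ∈ C ∧ hammingNorm x = W} := by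
    have := Finset.sum_card_bipartiteAbove_eq_sum_card_bipartiteBelow
      (s := S) (t := (univ : Finset (auxG ι F))) (fun x g => auxAct g x ∈ C)
    simp only [bipartiteAbove, bipartiteBelow, hg] at this
    simpa [N] using this
  have h2 : ∑ t : auxG ι F × auxG ι F,
      #{x : ι → F | auxAct t.1 x ∈ C ∧ auxAct t.2 x ∈ C ∧ hammingNorm x = W} = ∑ x ∈ S, N x ^ 2 := by
    have := Finset.sum_card_bipartiteAbove_eq_sum_card_bipartiteBelow
      (s := S) (t := (univ : Finset (auxG ι F × auxG ι F)))
      (fun x t => auxAct t.1 x ∈ C ∧ auxAct t.2 x ∈ C)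
    simp only [bipartiteAbove, bipartiteBelow] at this
    rw [Finset.sum_congr rfl (g := fun t : auxG ι F × auxG ι F => #{x ∈ S | auxAct t.1 x ∈ C ∧ auxAct t.2 x ∈ C}), ← this]
    · apply Finset.sum_congr rfl
      intro x _
      rw [sq, ← Finset.card_product]
      congr 1
      ext t
      simp
    · intro t _
      congr 1
      ext x
      simp only [hS, mem_filter, mem_univ, true_and]
      tauto
  have h3 : (∑ x ∈ S, N x ^ 2) * #S = (∑ x ∈ S, N x) ^ 2 := by
    rcases S.eq_empty_or_nonempty with h | ⟨x0, hx0⟩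
    · simp [h]
    · rw [Finset.sum_congr rfl (g := fun _ => N x0) (fun x hx => hconst x hx x0 hx0),
        Finset.sum_congr rfl (g := fun _ => N x0 ^ 2) (fun x hx => by rw [hconst x hx x0 hx0])]
      simp only [sum_const, smul_eq_mul]
      ring
  rw [h1, ← h2] at h3
  rw [← mul_pow]
  exact_mod_cast h3

/-- Let q be a prime power, let C0 = RS(Δ0,k0) be a Reed–Solomon code over F_q,
let b ≥ 1 and n = bΔ0, and consider the two-layer ensemble E1(Δ0,b) with base code C_b = C0^b.
Then for every W with 0 ≤ W ≤ n, the ensemble-average number of weight-W codewords satisfies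
Ā(W) = A(W)² / ((q−1)^W · binom(n,W)), where A(W) = #{y ∈ C_b : wt(y) = W}. -/
theorem statement_3 (q Δ0 k0 : ℕ) (hq : IsPrimePow q)
    (F : Type) [Field F] [Fintype F] [DecidableEq F] (hF : Fintype.card F = q)
    (hk0 : 1 ≤ k0) (hk0' : k0 ≤ Δ0) (hΔ0q : Δ0 ≤ q)
    (α : Fin Δ0 → F) (hα : Function.Injective α)
    (C0 : Set (Fin Δ0 → F))
    (hC0 : C0 = {y | ∃ p : Polynomial F, p.degree < (k0 : ℕ) ∧ ∀ j, y j = p.eval (α j)})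
    (b : ℕ) (hb : 1 ≤ b) (n : ℕ) (hn : n = b * Δ0)
    (Cb : Set (Fin b × Fin Δ0 → F))
    (hCb : Cb = {x | ∀ i : Fin b, (fun j => x (i, j)) ∈ C0})
    (W : ℕ) (hW : W ≤ n)
    (A : ℕ) (hA : A = Nat.card {y : Fin b × Fin Δ0 → F // y ∈ Cb ∧ hammingNorm y = W}) :
    (∑ t : (Equiv.Perm (Fin b × Fin Δ0) × {c : Fin b × Fin Δ0 → F // ∀ j, c j ≠ 0}) ×
           (Equiv.Perm (Fin b × Fin Δ0) × {c : Fin b × Fin Δ0 → F // ∀ j, c j ≠ 0}),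
        (Nat.card {x : Fin b × Fin Δ0 → F //
            (fun j => (t.1.2 : Fin b × Fin Δ0 → F) j * x (t.1.1 j)) ∈ Cb ∧
            (fun j => (t.2.2 : Fin b × Fin Δ0 → F) j * x (t.2.1 j)) ∈ Cb ∧
            hammingNorm x = W} : ℚ))
      / ((n.factorial : ℚ) * ((q : ℚ) - 1) ^ n) ^ 2
    = (A : ℚ) ^ 2 / (((q : ℚ) - 1) ^ W * (n.choose W : ℚ)) := by
  classical
  have hcard : Fintype.card (Fin b × Fin Δ0) = n := by simp [hn]
  have hm := aux_main Cb W (hcard.symm ▸ hW)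
  rw [aux_cardG, aux_sphere, hcard, hF] at hm
  have hq1 : 1 < q := hq.one_lt
  have hq' : ((q : ℚ) - 1) ≠ 0 := by
    have : (1 : ℚ) < q := by exact_mod_cast hq1
    linarith
  have hch : (n.choose W : ℚ) ≠ 0 := by exact_mod_cast (Nat.choose_pos hW).ne'
  have hfa : (n.factorial : ℚ) ≠ 0 := by exact_mod_cast n.factorial_ne_zero
  rw [div_eq_div_iff (by positivity) (by positivity), hA]
  simp only [Nat.card_eq_fintype_card, Fintype.card_subtype]
  push_cast [Nat.cast_sub hq1.le] at hm
  rw [mul_comm (_ ^ 2) (_ ^ 2)] at hm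
  refine Eq.trans ?_ hm
  congr 1
end

section
/- Let q be a prime power and let Δ0 ≥ 1 and 0 ≤ k ≤ Δ0 be integers. Then there exists a linear code C ⊆ F_q^{Δ0} with dim(C) ≥ k such that #{c ∈ C : wt(c) = 0} = 1 and, for every W with 1 ≤ W ≤ Δ0, #{c ∈ C : wt(c) = W} ≤ 2Δ0 · binom(Δ0,W) · (q−1)^W · q^{k−Δ0}. -/
lemma aux_weight (n W : ℕ) (F : Type) [Field F] [Fintype F] [DecidableEq F] :
    (Finset.univ.filter (fun c : Fin n → F => hammingNorm c = W)).card
      = n.choose W * (Fintype.card F - 1) ^ W := by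
  classical
  have h := Finset.card_eq_sum_card_fiberwise
    (s := Finset.univ.filter (fun c : Fin n → F => hammingNorm c = W))
    (t := Finset.powersetCard W (Finset.univ : Finset (Fin n)))
    (f := fun c => Finset.univ.filter (fun i => c i ≠ 0)) (by
      intro c hc
      simp [hammingNorm] at hc
      simp [Finset.mem_powersetCard, hc])
  rw [h]
  have h2 : ∀ s ∈ Finset.powersetCard W (Finset.univ : Finset (Fin n)),
      ((Finset.univ.filter (fun c : Fin n → F => hammingNorm c = W)).filter
        (fun c => Finset.univ.filter (fun i => c i ≠ 0) = s)).card
        = (Fintype.card F - 1) ^ W := by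
    intro s hs
    have hs' : s.card = W := (Finset.mem_powersetCard.1 hs).2
    have : ((Finset.univ.filter (fun c : Fin n → F => hammingNorm c = W)).filter
        (fun c => Finset.univ.filter (fun i => c i ≠ 0) = s))
        = Fintype.piFinset (fun i => if i ∈ s then Finset.univ.erase (0 : F) else {0}) := by
      ext c
      simp only [Finset.mem_filter, Finset.mem_univ, true_and, Fintype.mem_piFinset]
      constructor
      · rintro ⟨_, rfl⟩ i
        by_cases hi : c i = 0 <;> simp [hi]
      · intro hc
        have e : Finset.univ.filter (fun i => c i ≠ 0) = s := by
          ext i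
          have := hc i
          by_cases hi : i ∈ s <;> simp_all
        refine ⟨?_, e⟩
        rw [← hs', ← e]; rfl
    rw [this, Fintype.card_piFinset]
    have h3 : ∀ i, (if i ∈ s then Finset.univ.erase (0 : F) else {0}).card
        = if i ∈ s then (Fintype.card F - 1) else 1 := by
      intro i; split_ifs <;> simp [Finset.card_erase_of_mem]
    simp_rw [h3]
    simp [Finset.prod_ite, hs']
  rw [Finset.sum_congr rfl h2]
  simp

lemma aux_ker (m n : ℕ) (F : Type) [Field F] [Fintype F] [DecidableEq F]
    (c : Fin n → F) (hc : c ≠ 0) :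
    (Finset.univ.filter (fun H : Matrix (Fin m) (Fin n) F => H.mulVec c = 0)).card
      * Fintype.card F ^ m = Fintype.card (Matrix (Fin m) (Fin n) F) := by
  classical
  obtain ⟨j, hj⟩ := Function.ne_iff.1 hc
  let f : Matrix (Fin m) (Fin n) F →ₗ[F] (Fin m → F) :=
    { toFun := fun H => H.mulVec c
      map_add' := fun A B => Matrix.add_mulVec A B c
      map_smul' := fun a A => Matrix.smul_mulVec a A c }
  have hf : Function.Surjective f := by
    intro v
    refine ⟨Matrix.of fun i l => if l = j then v i * (c j)⁻¹ else 0, ?_⟩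
    ext i
    have hj' : c j ≠ 0 := hj
    simp [f, Matrix.mulVec, dotProduct, hj']
  have h1 := Submodule.card_eq_card_quotient_mul_card (LinearMap.ker f)
  have h2 := Nat.card_congr (f.quotKerEquivOfSurjective hf).toEquiv
  rw [h2] at h1
  have h3 : Nat.card (LinearMap.ker f)
      = (Finset.univ.filter (fun H : Matrix (Fin m) (Fin n) F => H.mulVec c = 0)).card := by
    rw [← Fintype.card_subtype, ← Nat.card_eq_fintype_card]; rfl
  rw [h3] at h1
  rw [← Nat.card_eq_fintype_card (α := Matrix (Fin m) (Fin n) F), h1]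
  simp [mul_comm]


/-- Let q be a prime power and let Δ0 ≥ 1 and 0 ≤ k ≤ Δ0 be integers.  Then
there exists a linear code C ⊆ F_q^{Δ0} with dim(C) ≥ k such that #{c ∈ C : wt(c) = 0} = 1
and, for every W with 1 ≤ W ≤ Δ0,
#{c ∈ C : wt(c) = W} ≤ 2Δ0 · binom(Δ0,W) · (q−1)^W · q^{k−Δ0}. -/
theorem statement_7 (q Δ0 k : ℕ) (hq : IsPrimePow q)
    (F : Type) [Field F] [Fintype F] [DecidableEq F] (hF : Fintype.card F = q)
    (hΔ0 : 1 ≤ Δ0) (hk : k ≤ Δ0) :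
    ∃ C : Submodule F (Fin Δ0 → F),
      k ≤ Module.finrank F C ∧
      Nat.card {c : Fin Δ0 → F // c ∈ C ∧ hammingNorm c = 0} = 1 ∧
      ∀ W : ℕ, 1 ≤ W → W ≤ Δ0 →
        (Nat.card {c : Fin Δ0 → F // c ∈ C ∧ hammingNorm c = W} : ℚ)
          ≤ 2 * (Δ0 : ℚ) * (Δ0.choose W : ℚ) * ((q : ℚ) - 1) ^ W
              * (q : ℚ) ^ ((k : ℤ) - (Δ0 : ℤ)) := by
  classical
  subst hF
  set q := Fintype.card F with hqdef
  have hq2 : 1 < q := Fintype.one_lt_card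
  have hqQ : (1 : ℚ) < q := by exact_mod_cast hq2
  let m := Δ0 - k
  let E : ℕ → ℚ := fun W => (Δ0.choose W : ℚ) * ((q : ℚ) - 1) ^ W * (q : ℚ) ^ ((k : ℤ) - (Δ0 : ℤ))
  have hE : ∀ W, W ≤ Δ0 → 0 < E W := by
    intro W hW
    have h1 : (0 : ℚ) < Δ0.choose W := by exact_mod_cast Nat.choose_pos hW
    have h2 : (0 : ℚ) < (q : ℚ) - 1 := by linarith
    have h3 : (0 : ℚ) < q := by linarith
    positivity
  let N : Matrix (Fin m) (Fin Δ0) F → ℕ → ℕ := fun H W =>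
    (Finset.univ.filter (fun c : Fin Δ0 → F => hammingNorm c = W ∧ H.mulVec c = 0)).card
  have hsum : ∀ W ∈ Finset.Icc 1 Δ0, ∑ H, (N H W : ℚ) / E W
      = Fintype.card (Matrix (Fin m) (Fin Δ0) F) := by
    intro W hW
    obtain ⟨hW1, hW2⟩ := Finset.mem_Icc.1 hW
    have hn : (∑ H, N H W) * q ^ m = (Δ0.choose W * (q - 1) ^ W)
        * Fintype.card (Matrix (Fin m) (Fin Δ0) F) := by
      have : ∑ H, N H W = ∑ c ∈ Finset.univ.filter (fun c : Fin Δ0 → F => hammingNorm c = W),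
          (Finset.univ.filter (fun H : Matrix (Fin m) (Fin Δ0) F => H.mulVec c = 0)).card := by
        simp only [N, ← Finset.filter_filter]
        simp_rw [Finset.card_filter _ (Finset.filter _ _)]
        rw [Finset.sum_comm]
        simp_rw [Finset.card_filter]
      rw [this, Finset.sum_mul, ← aux_weight, ← smul_eq_mul, ← Finset.sum_const]
      refine Finset.sum_congr rfl fun c hc => aux_ker m Δ0 F c ?_
      rintro rfl
      simp at hc
      omega
    have hnQ : (∑ H, (N H W : ℚ)) * (q : ℚ) ^ m = ((Δ0.choose W : ℚ) * ((q : ℚ) - 1) ^ W)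
        * Fintype.card (Matrix (Fin m) (Fin Δ0) F) := by
      have := congrArg (Nat.cast : ℕ → ℚ) hn
      push_cast [Nat.cast_sub hq2.le] at this
      exact this
    have hqm : (q : ℚ) ^ ((k : ℤ) - (Δ0 : ℤ)) * (q : ℚ) ^ m = 1 := by
      rw [← zpow_natCast, ← zpow_add₀ (by linarith)]
      have : (k : ℤ) - Δ0 + (m : ℕ) = 0 := by simp only [m]; omega
      rw [this, zpow_zero]
    rw [← Finset.sum_div, div_eq_iff (hE W hW2).ne']
    have hqp : (q : ℚ) ^ m ≠ 0 := by positivity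
    apply mul_right_cancel₀ hqp
    rw [hnQ]
    simp only [E]
    linear_combination (-((Δ0.choose W : ℚ) * ((q : ℚ) - 1) ^ W)
        * Fintype.card (Matrix (Fin m) (Fin Δ0) F)) * hqm
  obtain ⟨H, -, hH⟩ : ∃ H ∈ (Finset.univ : Finset (Matrix (Fin m) (Fin Δ0) F)),
      ∑ W ∈ Finset.Icc 1 Δ0, (N H W : ℚ) / E W ≤ (Δ0 : ℚ) := by
    apply Finset.exists_le_of_sum_le Finset.univ_nonempty
    rw [Finset.sum_comm, Finset.sum_congr rfl hsum]
    simp [mul_comm]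
  refine ⟨LinearMap.ker H.mulVecLin, ?_, ?_, ?_⟩
  · have h1 := LinearMap.finrank_range_add_finrank_ker H.mulVecLin
    have h2 := Submodule.finrank_le (LinearMap.range H.mulVecLin)
    simp at h1 h2
    omega
  · rw [Nat.card_eq_one_iff_unique]
    refine ⟨⟨fun a b => ?_⟩, ⟨⟨0, by simp⟩⟩⟩
    apply Subtype.ext
    rw [hammingNorm_eq_zero.1 a.2.2, hammingNorm_eq_zero.1 b.2.2]
  · intro W hW1 hW2
    have hc : Nat.card {c : Fin Δ0 → F // c ∈ LinearMap.ker H.mulVecLin ∧ hammingNorm c = W}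
        = N H W := by
      rw [Nat.card_eq_fintype_card, Fintype.card_subtype]
      simp only [N, LinearMap.mem_ker, Matrix.mulVecLin_apply, and_comm]
    rw [hc]
    have h1 : (N H W : ℚ) / E W ≤ Δ0 := le_trans
      (Finset.single_le_sum (f := fun W => (N H W : ℚ) / E W)
        (fun i hi => div_nonneg (by positivity) (hE i (Finset.mem_Icc.1 hi).2).le)
        (Finset.mem_Icc.2 ⟨hW1, hW2⟩)) hH
    rw [div_le_iff₀ (hE W hW2)] at h1
    have h2 : 0 ≤ (Δ0 : ℚ) * E W := mul_nonneg (by positivity) (hE W hW2).le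
    calc (N H W : ℚ) ≤ 2 * ((Δ0 : ℚ) * E W) := by linarith
      _ = _ := by simp only [E]; ring
end

section
/- Let q be a prime power, let C0 = RS(Δ0,k0) be a Reed–Solomon code over F_q with weight enumerator g0(s), and let ℓ ≥ 2 be an integer. Define F3(δ) = (ℓ−1)·( h_q(δ) + δ·log_q(q−1) ) + ℓ·sup_{s>0}( δ·log_q(s) − (1/Δ0)·log_q(g0(s)) ) for δ ∈ (0,1). Suppose δ3 ∈ (0,1) satisfies F3(δ3) = 0 and F3(δ) > 0 for all δ ∈ (0,δ3). Then for every ε ∈ (0,δ3), the fraction of ℓ-tuples (π1,c1,…,πℓ,cℓ) indexing the ℓ-layer ensemble E3(Δ0,b) (with n = bΔ0) whose code C(π1,c1,…,πℓ,cℓ) has minimum distance at least (δ3 − ε)·n tends to 1 as b → ∞. -/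
namespace S11
open Finset
abbrev G (ι F : Type) [Field F] := Equiv.Perm ι × {c : ι → F // ∀ j, c j ≠ 0}

def act {ι F : Type} [Field F] (g : G ι F) (x : ι → F) : ι → F := fun j => g.2.1 j * x (g.1 j)

lemma act_inj {ι F : Type} [Field F] (g : G ι F) : Function.Injective (act g) := by
  intro x y h
  funext j
  have := congrFun h (g.1.symm j)
  simp only [act, Equiv.apply_symm_apply] at this
  exact mul_left_cancel₀ (g.2.2 _) this

lemma act_norm {ι F : Type} [Field F] [Fintype ι] [DecidableEq F] (g : G ι F) (x : ι → F) :
    hammingNorm (act g x) = hammingNorm x := by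
  unfold hammingNorm
  apply Finset.card_bij (fun j _ => g.1 j)
  · intro j hj
    simp [act] at hj ⊢
    exact hj.2
  · intro a _ c _ h
    exact g.1.injective h
  · intro j hj
    refine ⟨g.1.symm j, ?_, by simp⟩
    simp [act] at hj ⊢
    exact ⟨g.2.2 _, hj⟩

lemma act_trans {ι F : Type} [Field F] [Fintype ι] [DecidableEq ι] [DecidableEq F] (x y : ι → F)
    (h : hammingNorm x = hammingNorm y) : ∃ g : G ι F, act g x = y := by
  have hc : Fintype.card {j // y j ≠ 0} = Fintype.card {j // x j ≠ 0} := by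
    rw [Fintype.card_subtype, Fintype.card_subtype]; exact h.symm
  let e := Fintype.equivOfCardEq hc
  let σ := e.extendSubtype
  have h1 : ∀ j, y j ≠ 0 → x (σ j) ≠ 0 := fun j hj => e.extendSubtype_mem j hj
  have h2 : ∀ j, ¬ y j ≠ 0 → ¬ x (σ j) ≠ 0 := fun j hj => e.extendSubtype_not_mem j hj
  refine ⟨(σ, ⟨fun j => if y j = 0 then 1 else y j / x (σ j), ?_⟩), ?_⟩
  · intro j
    by_cases hj : y j = 0
    · simp [hj]
    · simp [hj, h1 j hj]
  · funext j
    simp only [act]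
    by_cases hj : y j = 0
    · have := h2 j (by simpa using hj)
      simp at this
      simp [hj, this]
    · have := h1 j hj
      simp [hj]
      field_simp

open Classical in
noncomputable def T {ι F : Type} [Field F] [Fintype ι] [Fintype F] (B : Set (ι → F)) (x : ι → F) : ℕ :=
  (univ.filter (fun g : G ι F => act g x ∈ B)).card

open Classical in
noncomputable def W {ι F : Type} [Field F] [Fintype ι] [Fintype F] [DecidableEq F] (B : Set (ι → F)) (w : ℕ) : ℕ :=
  (univ.filter (fun y : ι → F => y ∈ B ∧ hammingNorm y = w)).card

lemma T_le {ι F : Type} [Field F] [Fintype ι] [Fintype F] (B : Set (ι → F)) (x : ι → F) (g : G ι F) :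
    T B (act g x) ≤ T B x := by
  classical
  unfold T
  apply Finset.card_le_card_of_injOn
    (fun f : G ι F => ((f.1.trans g.1, ⟨fun j => f.2.1 j * g.2.1 (f.1 j),
      fun j => mul_ne_zero (f.2.2 j) (g.2.2 _)⟩) : G ι F))
  · intro f hf
    simp at hf ⊢
    convert hf using 1
    funext j
    simp [act, mul_assoc]
  · intro f hf f' hf' h
    simp only [Prod.mk.injEq, Subtype.mk.injEq] at h
    have h1 : f.1 = f'.1 := by
      ext j
      have := congrArg (fun e : Equiv.Perm ι => e j) h.1
      simpa using this
    refine Prod.ext h1 (Subtype.ext ?_)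
    funext j
    have := congrFun h.2 j
    rw [h1] at this
    exact mul_right_cancel₀ (g.2.2 _) this

lemma T_eq {ι F : Type} [Field F] [Fintype ι] [Fintype F] [DecidableEq F] (B : Set (ι → F)) (x y : ι → F)
    (h : hammingNorm x = hammingNorm y) : T B x = T B y := by
  classical
  apply le_antisymm
  · obtain ⟨g, rfl⟩ := act_trans y x h.symm
    exact T_le B y g
  · obtain ⟨g, rfl⟩ := act_trans x y h
    exact T_le B x g

lemma T_mul {ι F : Type} [Field F] [Fintype ι] [Fintype F] [DecidableEq F] (B : Set (ι → F)) (x : ι → F) :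
    T B x * W (Set.univ : Set (ι → F)) (hammingNorm x) = Nat.card (G ι F) * W B (hammingNorm x) := by
  classical
  have h1 : ∑ y ∈ univ.filter (fun y : ι → F => hammingNorm y = hammingNorm x), T B y
      = W (Set.univ : Set (ι → F)) (hammingNorm x) * T B x := by
    rw [Finset.sum_congr rfl (g := fun _ => T B x)]
    · rw [Finset.sum_const, smul_eq_mul]
      congr 1
      unfold W
      congr 1
      ext y
      simp
    · intro y hy
      exact T_eq B y x (by simpa using hy)
  have h2 : ∑ y ∈ univ.filter (fun y : ι → F => hammingNorm y = hammingNorm x), T B y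
      = ∑ g : G ι F, W B (hammingNorm x) := by
    have h3 : ∀ g : G ι F, W B (hammingNorm x) = ((univ.filter (fun y : ι → F => hammingNorm y = hammingNorm x)).filter (fun y => act g y ∈ B)).card := by
      intro g
      unfold W
      symm
      apply Finset.card_bij (fun y _ => act g y)
      · intro y hy
        simp [act_norm] at hy ⊢
        exact ⟨hy.2, hy.1⟩
      · intro y _ z _ h
        exact act_inj g h
      · intro z hz
        obtain ⟨y, rfl⟩ := (Finite.injective_iff_surjective.mp (act_inj g)) z
        simp [act_norm] at hz
        exact ⟨y, by simp [hz], rfl⟩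
    rw [Finset.sum_congr rfl (fun g _ => h3 g)]
    unfold T
    simp only [Finset.card_filter]
    rw [Finset.sum_comm]
    congr!
  rw [mul_comm, ← h1, h2, Nat.card_eq_fintype_card, Finset.sum_const, smul_eq_mul, Finset.card_univ]

lemma W_mono {ι F : Type} [Field F] [Fintype ι] [Fintype F] [DecidableEq F] (w : ℕ) :
    (Fintype.card ι).choose w * (Fintype.card F - 1)^w ≤ W (Set.univ : Set (ι → F)) w := by
  classical
  have : (∑ S ∈ powersetCard w (univ : Finset ι), (Fintype.piFinset (fun i => if i ∈ S then (univ.erase (0:F)) else {0})).card) = (Fintype.card ι).choose w * (Fintype.card F - 1)^w := by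
    rw [Finset.sum_congr rfl (g := fun _ => (Fintype.card F - 1)^w)]
    · simp
    · intro S hS
      rw [mem_powersetCard] at hS
      rw [Fintype.card_piFinset]
      rw [Finset.prod_congr rfl (g := fun i => if i ∈ S then (Fintype.card F - 1) else 1)]
      · rw [Finset.prod_ite_mem]
        simp [hS.2]
      · intro i _
        split_ifs <;> simp [Finset.card_erase_of_mem]
  have key : ∀ S : Finset ι, ∀ y ∈ (Fintype.piFinset (fun i => if i ∈ S then (univ.erase (0:F)) else {0})), (univ.filter (fun i => y i ≠ 0)) = S := by
    intro S y hy
    ext i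
    have := (Fintype.mem_piFinset.mp hy) i
    by_cases h : i ∈ S <;> simp [h] at this ⊢ <;> exact this
  rw [← this, ← Finset.card_biUnion]
  · unfold W
    apply card_le_card
    intro y hy
    rw [mem_biUnion] at hy
    obtain ⟨S, hS, hy⟩ := hy
    rw [mem_powersetCard] at hS
    simp only [mem_filter, mem_univ, true_and, Set.mem_univ]
    unfold hammingNorm
    rw [key S y hy, hS.2]
  · intro S hS S' hS' hne
    rw [Function.onFun, Finset.disjoint_left]
    intro y hy hy'
    exact hne ((key S y hy).symm.trans (key S' y hy'))

/-- union bound -/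
lemma union_bound {ι F : Type} [Field F] [Fintype ι] [Fintype F] [DecidableEq F] (B : Set (ι → F)) (ℓ : ℕ) (r : ℝ) :
    (1 : ℝ) - (∑ w ∈ (range (Fintype.card ι + 1)).filter (fun w : ℕ => 1 ≤ w ∧ (w:ℝ) < r),
      (W (Set.univ : Set (ι → F)) w : ℝ) * ((W B w : ℝ) / W (Set.univ : Set (ι → F)) w) ^ ℓ) ≤ 
    (Nat.card {t : Fin ℓ → G ι F // ∀ x : ι → F, (∀ l, act (t l) x ∈ B) → x ≠ 0 → r ≤ (hammingNorm x : ℝ)} : ℝ) / (Nat.card (Fin ℓ → G ι F) : ℝ) := by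
  classical
  set N := Nat.card (G ι F) with hN
  have hNpos : 0 < N := by
    have : Nonempty (G ι F) := ⟨(1, ⟨fun _ => 1, by simp⟩)⟩
    exact Nat.card_pos
  have hcard : (Nat.card (Fin ℓ → G ι F) : ℝ) = (N:ℝ)^ℓ := by
    rw [Nat.card_fun]; simp [N]
  have hX : ∀ x : ι → F, ((univ.filter (fun t : Fin ℓ → G ι F => ∀ l, act (t l) x ∈ B)).card) = T B x ^ ℓ := by
    intro x
    have : (univ.filter (fun t : Fin ℓ → G ι F => ∀ l, act (t l) x ∈ B)) = Fintype.piFinset (fun _ => univ.filter (fun g : G ι F => act g x ∈ B)) := by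
      ext t; simp [Fintype.mem_piFinset]
    rw [this, Fintype.card_piFinset]
    simp [T]
    congr!
  set Xs := univ.filter (fun x : ι → F => x ≠ 0 ∧ (hammingNorm x : ℝ) < r) with hXs
  have hcov : N^ℓ ≤ Nat.card {t : Fin ℓ → G ι F // ∀ x : ι → F, (∀ l, act (t l) x ∈ B) → x ≠ 0 → r ≤ (hammingNorm x : ℝ)} + ∑ x ∈ Xs, T B x ^ ℓ := by
    have e1 : N^ℓ = (univ : Finset (Fin ℓ → G ι F)).card := by
      rw [Finset.card_univ, ← Nat.card_eq_fintype_card, Nat.card_fun]; simp [N]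
    rw [e1, Nat.card_eq_fintype_card, Fintype.card_subtype]
    calc _ ≤ ((univ.filter (fun t : Fin ℓ → G ι F => ∀ x : ι → F, (∀ l, act (t l) x ∈ B) → x ≠ 0 → r ≤ (hammingNorm x : ℝ))) ∪ Xs.biUnion (fun x => univ.filter (fun t : Fin ℓ → G ι F => ∀ l, act (t l) x ∈ B))).card := by
          apply card_le_card
          intro t _
          rw [mem_union, mem_biUnion]
          by_contra hcon
          push Not at hcon
          apply hcon.1
          simp only [mem_filter, mem_univ, true_and]
          intro x hx hx0
          by_contra hr
          exact hcon.2 x (by simp only [hXs, mem_filter, mem_univ, true_and]; exact ⟨hx0, not_le.mp hr⟩) (by simpa using hx)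
      _ ≤ _ := by
          refine (card_union_le _ _).trans ?_
          gcongr
          refine card_biUnion_le.trans ?_
          rw [Finset.sum_congr rfl (fun x _ => hX x)]
  have hN' : (0:ℝ) < (N:ℝ)^ℓ := by positivity
  rw [hcard, sub_le_iff_le_add, div_add' _ _ _ hN'.ne', le_div_iff₀ hN', one_mul]
  have hcov' : (N:ℝ)^ℓ ≤ Nat.card {t : Fin ℓ → G ι F // ∀ x : ι → F, (∀ l, act (t l) x ∈ B) → x ≠ 0 → r ≤ (hammingNorm x : ℝ)} + ∑ x ∈ Xs, (T B x : ℝ) ^ ℓ := by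
    exact_mod_cast hcov
  refine hcov'.trans ?_
  gcongr
  rw [Finset.sum_mul]
  have hmaps : ∀ x ∈ Xs, hammingNorm x ∈ (range (Fintype.card ι + 1)).filter (fun w : ℕ => 1 ≤ w ∧ (w:ℝ) < r) := by
    intro x hx
    simp only [hXs, mem_filter, mem_univ, true_and] at hx
    simp only [mem_filter, mem_range]
    refine ⟨Nat.lt_succ_of_le hammingNorm_le_card_fintype, ?_, hx.2⟩
    exact hammingNorm_pos_iff.mpr hx.1
  rw [← Finset.sum_fiberwise_of_maps_to hmaps]
  apply Finset.sum_le_sum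
  intro w hw
  have hTx : ∀ x : ι → F, hammingNorm x = w → (T B x : ℝ) = (W B w : ℝ) / W (Set.univ : Set (ι → F)) w * N := by
    intro x hx
    have h := T_mul B x
    rw [hx] at h
    have hpos : 0 < W (Set.univ : Set (ι → F)) w := by
      unfold W
      apply card_pos.mpr
      exact ⟨x, by simp [hx]⟩
    have hpos' : (0:ℝ) < W (Set.univ : Set (ι → F)) w := by exact_mod_cast hpos
    have h' : (T B x : ℝ) * W (Set.univ : Set (ι → F)) w = N * W B w := by exact_mod_cast h
    field_simp
    linarith
  rw [Finset.sum_congr rfl (g := fun _ => ((W B w : ℝ) / W (Set.univ : Set (ι → F)) w * N)^ℓ)]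
  · rw [Finset.sum_const, nsmul_eq_mul, mul_pow, ← mul_assoc]
    gcongr
    unfold W
    apply card_le_card
    intro x hx
    simp at hx ⊢
    exact hx.2
  · intro x hx
    simp only [mem_filter] at hx
    rw [hTx x hx.2]

/-- generating function -/
lemma W_gen {F : Type} [Field F] [Fintype F] [DecidableEq F] (b D : ℕ) (C : Set (Fin D → F)) (g : ℝ → ℝ)
    (hg : ∀ s : ℝ, g s = ∑ᶠ y ∈ C, s ^ hammingNorm y) (s : ℝ) (hs : 0 < s) (w : ℕ) :
    (W {y : Fin b × Fin D → F | ∀ i, (fun j => y (i, j)) ∈ C} w : ℝ) * s ^ w ≤ g s ^ b := by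
  classical
  have e1 : g s = ∑ y ∈ univ.filter (fun y => y ∈ C), s ^ hammingNorm y := by
    rw [hg]
    rw [← finsum_mem_coe_finset]
    simp
  have e2 : g s ^ b = ∑ p ∈ Fintype.piFinset (fun _ : Fin b => univ.filter (fun y => y ∈ C)), ∏ i, s ^ hammingNorm (p i) := by
    rw [← Finset.prod_univ_sum (fun _ : Fin b => univ.filter (fun y => y ∈ C)) (fun _ y => s ^ hammingNorm y), e1]; simp
  rw [e2]
  unfold W
  rw [← nsmul_eq_mul, ← Finset.sum_const]
  have hinj : Function.Injective (fun (y : Fin b × Fin D → F) => fun i j => y (i, j)) := by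
    intro y z h
    funext ⟨i, j⟩
    exact congrFun (congrFun h i) j
  refine le_trans (le_of_eq ?_) (Finset.sum_le_sum_of_subset_of_nonneg (s := (univ.filter (fun y : Fin b × Fin D → F => y ∈ {y : Fin b × Fin D → F | ∀ i, (fun j => y (i, j)) ∈ C} ∧ hammingNorm y = w)).image (fun (y : Fin b × Fin D → F) => fun i j => y (i, j))) ?_ ?_)
  · rw [Finset.sum_image (fun _ _ _ _ h => hinj h)]
    apply Finset.sum_congr (by congr!)
    intro y hy
    simp only [mem_filter] at hy
    rw [Finset.prod_pow_eq_pow_sum, ← hy.2.2]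
    congr 1
    unfold hammingNorm
    simp only [Finset.card_filter]
    rw [Fintype.sum_prod_type]
  · intro p hp
    rw [mem_image] at hp
    obtain ⟨y, hy, rfl⟩ := hp
    simp only [mem_filter, mem_univ, true_and] at hy
    rw [Fintype.mem_piFinset]
    intro i
    simpa using hy.1 i
  · intros; positivity

lemma rs_dist {F : Type} [Field F] [Fintype F] [DecidableEq F] {D k : ℕ} (hk : 1 ≤ k) (hkD : k ≤ D)
    (α : Fin D → F) (hα : Function.Injective α) (p : Polynomial F) (hp : p.degree < (k:ℕ))
    (y : Fin D → F) (hy : ∀ j, y j = p.eval (α j)) (h0 : y ≠ 0) : D - k + 1 ≤ hammingNorm y := by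
  classical
  have hp0 : p ≠ 0 := by
    rintro rfl
    apply h0
    funext j
    simp [hy]
  have h1 : (univ.filter (fun j => y j = 0)).card ≤ p.natDegree := by
    refine le_trans ?_ (Polynomial.card_roots' p)
    refine le_trans ?_ (Multiset.toFinset_card_le _)
    apply Finset.card_le_card_of_injOn α
    · intro j hj
      simp [hy] at hj
      simp [hp0, hj]
    · exact hα.injOn
  have h2 : p.natDegree < k := (Polynomial.natDegree_lt_iff_degree_lt hp0).mpr hp
  have h3 := Finset.card_filter_add_card_filter_not (s := (univ : Finset (Fin D))) (fun j => y j = 0)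
  simp only [card_univ, Fintype.card_fin] at h3
  unfold hammingNorm
  simp only [ne_eq]
  omega

lemma g_eq {F : Type} [Field F] [Fintype F] [DecidableEq F] {D : ℕ} (C : Set (Fin D → F)) [DecidablePred (· ∈ C)] (s : ℝ) :
    ∑ᶠ y ∈ C, s ^ hammingNorm y = ∑ y ∈ univ.filter (fun y => y ∈ C), s ^ hammingNorm y := by
  rw [← finsum_mem_coe_finset]
  simp

lemma g_upper {F : Type} [Field F] [Fintype F] [DecidableEq F] {D k : ℕ} (hk : 1 ≤ k) (hkD : k ≤ D)
    (α : Fin D → F) (hα : Function.Injective α) (s : ℝ) (hs : 0 < s) (hs1 : s ≤ 1) :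
    ∑ᶠ y ∈ {y : Fin D → F | ∃ p : Polynomial F, p.degree < (k : ℕ) ∧ ∀ j, y j = p.eval (α j)}, s ^ hammingNorm y
      ≤ 1 + (Fintype.card F : ℝ)^D * s ^ (D - k + 1) := by
  classical
  rw [g_eq]
  calc _ ≤ ∑ y : Fin D → F, ((if y = 0 then 1 else 0) + s ^ (D-k+1)) := by
        refine le_trans (Finset.sum_le_sum (g := fun y => ((if y = 0 then 1 else 0) + s ^ (D-k+1))) ?_) (Finset.sum_le_sum_of_subset_of_nonneg (Finset.subset_univ _) ?_)
        · intro y hy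
          simp only [mem_filter, mem_univ, true_and, Set.mem_ofPred_eq] at hy
          obtain ⟨p, hp, hy⟩ := hy
          by_cases h : y = 0
          · simp [h]; positivity
          · simp only [h, if_false, zero_add]
            exact pow_le_pow_of_le_one hs.le hs1 (rs_dist hk hkD α hα p hp y hy h)
        · intros; positivity
    _ = _ := by
        rw [Finset.sum_add_distrib]
        simp

lemma g_lower {F : Type} [Field F] [Fintype F] [DecidableEq F] {D k : ℕ} (hk : 1 ≤ k) (hkD : k ≤ D)
    (α : Fin D → F) (hα : Function.Injective α) (s : ℝ) (hs : 0 < s) :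
    1 + (D.choose (D - k + 1) : ℝ) * ((Fintype.card F : ℝ) - 1) * s ^ (D - k + 1) ≤
    ∑ᶠ y ∈ {y : Fin D → F | ∃ p : Polynomial F, p.degree < (k : ℕ) ∧ ∀ j, y j = p.eval (α j)}, s ^ hammingNorm y
       := by
  classical
  rw [g_eq]
  set d := D - k + 1 with hd
  let P : Finset (Fin D) × F → Polynomial F := fun z => Polynomial.C z.2 * ∏ m ∈ univ \ z.1, (Polynomial.X - Polynomial.C (α m))
  let Y : Finset (Fin D) × F → (Fin D → F) := fun z j => (P z).eval (α j)
  let I : Finset (Finset (Fin D) × F) := powersetCard d univ ×ˢ univ.erase 0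
  have hsupp : ∀ z ∈ I, univ.filter (fun j => Y z j ≠ 0) = z.1 := by
    rintro ⟨S, c⟩ hz
    simp only [I, mem_product, mem_powersetCard, mem_erase] at hz
    ext j
    simp only [Y, P, mem_filter, mem_univ, true_and, Polynomial.eval_mul, Polynomial.eval_C, Polynomial.eval_prod, Polynomial.eval_sub, Polynomial.eval_X]
    rw [mul_ne_zero_iff, Finset.prod_ne_zero_iff]
    constructor
    · intro h
      by_contra hj
      exact h.2 j (by simp [hj]) (sub_self _)
    · intro hj
      refine ⟨hz.2.1, ?_⟩
      intro m hm h
      have : j = m := hα (sub_eq_zero.mp h)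
      subst this
      simp at hm
      exact hm hj
  have hnorm : ∀ z ∈ I, hammingNorm (Y z) = d := by
    intro z hz
    unfold hammingNorm
    rw [hsupp z hz]
    simp only [I, mem_product, mem_powersetCard] at hz
    exact hz.1.2
  have hinj : Set.InjOn Y (I : Set (Finset (Fin D) × F)) := by
    rintro ⟨S, c⟩ hz ⟨S', c'⟩ hz' h
    have h1 : S = S' := by
      have a := hsupp _ hz
      have b := hsupp _ hz'
      rw [h] at a
      exact a.symm.trans b
    subst h1
    have hz2 := hz
    simp only [I, coe_product, Set.mem_prod, mem_coe, mem_powersetCard] at hz2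
    have hne : S.Nonempty := by
      rw [← card_pos]; omega
    obtain ⟨j, hj⟩ := hne
    have h2 : Y (S, c) j ≠ 0 := by
      have : j ∈ univ.filter (fun j => Y (S,c) j ≠ 0) := by rw [hsupp _ hz]; exact hj
      simpa using this
    have h3 := congrFun h j
    simp only [Y, P, Polynomial.eval_mul, Polynomial.eval_C] at h2 h3
    have := mul_right_cancel₀ (right_ne_zero_of_mul h2) h3
    rw [this]
  have hdeg : ∀ z ∈ I, (P z).degree < (k:ℕ) := by
    rintro ⟨S, c⟩ hz
    simp only [I, mem_product, mem_powersetCard, mem_erase] at hz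
    simp only [P]
    rw [Polynomial.degree_C_mul hz.2.1, Polynomial.degree_prod]
    simp only [Polynomial.degree_X_sub_C]
    rw [Finset.sum_const, Finset.card_sdiff_of_subset (subset_univ _), hz.1.2]
    simp
    omega
  have h0 : (0 : Fin D → F) ∉ I.image Y := by
    intro h
    rw [mem_image] at h
    obtain ⟨z, hz, h⟩ := h
    have := hnorm z hz
    rw [h, hammingNorm_zero] at this
    omega
  calc _ = ∑ y ∈ insert 0 (I.image Y), s ^ hammingNorm y := by
        rw [Finset.sum_insert h0, Finset.sum_image hinj, hammingNorm_zero, pow_zero,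
          Finset.sum_congr rfl (fun z hz => by rw [hnorm z hz]), Finset.sum_const]
        congr 1
        rw [nsmul_eq_mul]
        congr 1
        simp [I, Finset.card_erase_of_mem]
        left
        rw [Nat.cast_sub Fintype.card_pos]; simp
    _ ≤ _ := by
        apply Finset.sum_le_sum_of_subset_of_nonneg
        · intro y hy
          rw [mem_insert, mem_image] at hy
          simp only [mem_filter, mem_univ, true_and, Set.mem_ofPred_eq]
          rcases hy with rfl | ⟨z, hz, rfl⟩
          · exact ⟨0, by simp, by simp⟩
          · exact ⟨P z, hdeg z hz, fun j => rfl⟩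
        · intros; positivity

lemma poi (a k : ℕ) : a^k * a.factorial ≤ a^a * k.factorial := by
  rcases le_total k a with h | h
  · have h1 := Nat.factorial_mul_descFactorial (Nat.sub_le a k)
    rw [Nat.sub_sub_self h] at h1
    have h2 := Nat.descFactorial_le_pow a (a - k)
    calc a^k * a.factorial = a^k * (k.factorial * a.descFactorial (a-k)) := by rw [h1]
      _ ≤ a^k * (k.factorial * a^(a-k)) := by gcongr
      _ = (a^k * a^(a-k)) * k.factorial := by ring
      _ = _ := by rw [← pow_add]; congr 2; omega
  · have h1 := Nat.factorial_mul_pow_sub_le_factorial h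
    calc a^k * a.factorial = a^a * (a.factorial * a^(k-a)) := by
          have : a^k = a^a * a^(k-a) := by rw [← pow_add]; congr 1; omega
          rw [this]; ring
      _ ≤ _ := by gcongr

lemma choose_lower (n w : ℕ) (hw : w ≤ n) : n^n ≤ (n+1) * (n.choose w * w^w * (n-w)^(n-w)) := by
  have e : n^n = (w + (n-w))^n := by congr 1; omega
  rw [e, add_pow]
  calc _ ≤ ∑ k ∈ range (n+1), (n.choose w * w^w * (n-w)^(n-w)) := by
        apply Finset.sum_le_sum
        intro k hk
        have hk : k ≤ n := by simp at hk; omega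
        have hpos : 0 < k.factorial * (n-k).factorial * (w.factorial * (n-w).factorial) := by positivity
        apply le_of_mul_le_mul_right _ hpos
        have a := Nat.choose_mul_factorial_mul_factorial hk
        have b := Nat.choose_mul_factorial_mul_factorial hw
        have c := poi w k
        have d := poi (n-w) (n-k)
        simp only [Nat.cast_id]
        calc _ = (w^k * w.factorial) * ((n-w)^(n-k) * (n-w).factorial) * (n.choose k * k.factorial * (n-k).factorial) := by ring
          _ = (w^k * w.factorial) * ((n-w)^(n-k) * (n-w).factorial) * (n.choose w * w.factorial * (n-w).factorial) := by rw [a, b]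
          _ ≤ (w^w * k.factorial) * ((n-w)^(n-w) * (n-k).factorial) * (n.choose w * w.factorial * (n-w).factorial) := by gcongr
          _ = _ := by ring
    _ = _ := by simp

lemma choose_entropy (n w : ℕ) (hw0 : 0 < w) (hw : w < n) :
    Real.exp (n * Real.binEntropy ((w:ℝ)/n)) ≤ (n+1) * (n.choose w : ℝ) := by
  have h : (n:ℝ)^n ≤ (n+1) * (n.choose w * (w:ℝ)^w * ((n:ℝ)-w)^(n-w)) := by
    have := choose_lower n w hw.le
    have h2 : ((n^n : ℕ):ℝ) ≤ (((n+1) * (n.choose w * w^w * (n-w)^(n-w)) : ℕ):ℝ) := by exact_mod_cast this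
    push_cast [Nat.cast_sub hw.le] at h2
    exact h2
  have hw0' : (0:ℝ) < w := by exact_mod_cast hw0
  have hn' : (0:ℝ) < n := by exact_mod_cast (hw0.trans hw)
  have hnw : (0:ℝ) < (n:ℝ) - w := by rw [sub_pos]; exact_mod_cast hw
  have hP : (0:ℝ) < (w:ℝ)^w * ((n:ℝ)-w)^(n-w) := by positivity
  have e : Real.exp (n * Real.binEntropy ((w:ℝ)/n)) = (n:ℝ)^n / ((w:ℝ)^w * ((n:ℝ)-w)^(n-w)) := by
    rw [← Real.exp_log (show (0:ℝ) < (n:ℝ)^n / ((w:ℝ)^w * ((n:ℝ)-w)^(n-w)) by positivity)]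
    congr 1
    rw [Real.log_div (by positivity) (by positivity), Real.log_mul (by positivity) (by positivity), Real.log_pow, Real.log_pow, Real.log_pow]
    unfold Real.binEntropy
    have : 1 - (w:ℝ)/n = (n - w)/n := by field_simp
    rw [this, Real.log_inv, Real.log_inv, Real.log_div hw0'.ne' hn'.ne', Real.log_div hnw.ne' hn'.ne', Nat.cast_sub hw.le]
    field_simp
    ring
  rw [e, div_le_iff₀ hP]
  linarith

lemma choose_small (n w : ℕ) (hw0 : 0 < w) (hw : 2 * w ≤ n) :
    ((n:ℝ)/(2*w))^w ≤ (n.choose w : ℝ) := by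
  have h := Nat.pow_le_choose (α := ℝ) w n
  refine le_trans ?_ h
  have hf : (w.factorial : ℝ) ≤ (w:ℝ)^w := by exact_mod_cast Nat.factorial_le_pow w
  have hw0' : (0:ℝ) < w := by exact_mod_cast hw0
  have : ((n:ℝ)/2) ≤ ((n+1-w : ℕ):ℝ) := by
    rw [Nat.cast_sub (by omega)]
    push_cast
    have : 2*(w:ℝ) ≤ n := by exact_mod_cast hw
    linarith
  calc ((n:ℝ)/(2*w))^w = ((n:ℝ)/2)^w / (w:ℝ)^w := by rw [← div_pow]; congr 1; field_simp
    _ ≤ ((n+1-w : ℕ):ℝ)^w / (w.factorial : ℝ) := by gcongr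

lemma quot_le {A M A' M' : ℝ} (ℓ : ℕ) (hℓ : 1 ≤ ℓ) (hA : 0 ≤ A) (hAA : A ≤ A') (hM' : 0 < M') (hMM : M' ≤ M) :
    M * (A / M) ^ ℓ ≤ A' ^ ℓ / M' ^ (ℓ - 1) := by
  obtain ⟨m, rfl⟩ : ∃ m, ℓ = m + 1 := ⟨ℓ - 1, by omega⟩
  have hM : 0 < M := hM'.trans_le hMM
  have : M * (A / M) ^ (m+1) = A ^ (m+1) / M ^ m := by
    rw [div_pow, pow_succ M]
    field_simp
  rw [this, Nat.add_sub_cancel]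
  have hA' : 0 ≤ A' := hA.trans hAA
  gcongr

lemma small_term (n b D d ℓ w : ℕ) (hn : n = b * D) (hD : 1 ≤ D) (hd : 1 ≤ d) (hℓ : 1 ≤ ℓ) (K Q A M : ℝ) (hK : 0 ≤ K)
    (hQ : 1 ≤ Q) (g : ℝ → ℝ) (hg1 : ∀ s, 0 < s → 1 ≤ g s) (hg2 : ∀ s, 0 < s → s ≤ 1 → g s ≤ 1 + K * s ^ d)
    (hA0 : 0 ≤ A) (hA : ∀ s, 0 < s → A * s ^ w ≤ g s ^ b) (hM : (n.choose w : ℝ) * Q ^ w ≤ M)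
    (hw : 1 ≤ w) (hwn : 2 * w ≤ n) :
    M * (A / M) ^ ℓ ≤ ((Real.exp K ^ ℓ * 2 ^ (ℓ - 1)) * ((w:ℝ) / n) ^ ((ℓ:ℝ) - 1 - ℓ / d)) ^ w := by
  have hw' : (0:ℝ) < w := by exact_mod_cast hw
  have hn' : (0:ℝ) < n := by exact_mod_cast (by omega : 0 < n)
  set x : ℝ := (w:ℝ) / n with hx
  have hx0 : 0 < x := by positivity
  have hx1 : x ≤ 1 := by
    rw [hx, div_le_one hn']; exact_mod_cast (by omega : w ≤ n)
  set s : ℝ := x ^ (1 / (d:ℝ)) with hs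
  have hs0 : 0 < s := by positivity
  have hs1 : s ≤ 1 := Real.rpow_le_one hx0.le hx1 (by positivity)
  have hsd : s ^ d = x := by
    rw [hs, ← Real.rpow_natCast, ← Real.rpow_mul hx0.le]
    have : (d:ℝ) ≠ 0 := by positivity
    field_simp
    simp
  have hbx : b * x ≤ w := by
    have hb : (b:ℝ) ≤ n := by
      rw [hn]; exact_mod_cast Nat.le_mul_of_pos_right b hD
    rw [hx, ← mul_div_assoc, div_le_iff₀ hn']
    nlinarith
  have h1 : A ≤ (Real.exp K / s) ^ w := by
    rw [div_pow, le_div_iff₀ (by positivity)]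
    refine (hA s hs0).trans ?_
    calc g s ^ b ≤ (Real.exp (K * x)) ^ b := by
          have := hg1 s hs0
          gcongr
          have a := hg2 s hs0 hs1
          rw [hsd] at a
          have := Real.add_one_le_exp (K * x)
          linarith
      _ = Real.exp (K * (b * x)) := by rw [← Real.exp_nat_mul]; ring_nf
      _ ≤ Real.exp (K * w) := by gcongr
      _ = _ := by rw [← Real.exp_nat_mul]; ring_nf
  have h2 : (1 / (2 * x)) ^ w ≤ M := by
    refine le_trans ?_ hM
    have a := S11.choose_small n w hw hwn
    have e : (1 / (2 * x)) = (n:ℝ) / (2 * w) := by rw [hx]; field_simp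
    rw [e]
    refine a.trans ?_
    have : 1 ≤ Q ^ w := one_le_pow₀ hQ
    have h0 : (0:ℝ) ≤ n.choose w := by positivity
    nlinarith
  refine (quot_le ℓ hℓ hA0 h1 (by positivity) h2).trans (le_of_eq ?_)
  have e1 : x ^ ((ℓ:ℝ) - 1 - ℓ / d) = x ^ (ℓ - 1) / s ^ ℓ := by
    rw [Real.rpow_sub hx0, hs, ← Real.rpow_natCast (x ^ (1/(d:ℝ))), ← Real.rpow_mul hx0.le, ← Real.rpow_natCast x, Nat.cast_sub hℓ]
    congr 2
    · simp
    · ring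
  rw [e1, ← pow_mul, ← pow_mul, mul_comm w ℓ, mul_comm w (ℓ-1), pow_mul, pow_mul, ← div_pow]
  congr 1
  simp only [div_pow, mul_pow, one_pow]
  field_simp

lemma mid_term (n b D ℓ w : ℕ) (hn : n = b * D) (hD : 1 ≤ D) (hℓ : 1 ≤ ℓ) (Q A M c s : ℝ)
    (hQ : 1 ≤ Q) (g : ℝ → ℝ) (hs : 0 < s) (hg1 : 1 ≤ g s)
    (hA0 : 0 ≤ A) (hA : A * s ^ w ≤ g s ^ b) (hM : (n.choose w : ℝ) * Q ^ w ≤ M)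
    (hw : 1 ≤ w) (hwn : w < n)
    (hc : c ≤ ((ℓ:ℝ) - 1) * (Real.binEntropy ((w:ℝ)/n) + (w:ℝ)/n * Real.log Q) + ℓ * ((w:ℝ)/n * Real.log s - (1 / (D:ℝ)) * Real.log (g s))) :
    M * (A / M) ^ ℓ ≤ ((n:ℝ) + 1) ^ (ℓ - 1) * Real.exp (- c * n) := by
  have hw' : (0:ℝ) < w := by exact_mod_cast hw
  have hn' : (0:ℝ) < n := by exact_mod_cast (by omega : 0 < n)
  have hD' : (0:ℝ) < D := by exact_mod_cast hD
  have hg0 : 0 < g s := by linarith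
  have h1 : A ≤ Real.exp (b * Real.log (g s) - w * Real.log s) := by
    rw [Real.exp_sub, Real.exp_nat_mul, Real.exp_nat_mul, Real.exp_log hg0, Real.exp_log hs, le_div_iff₀ (by positivity)]
    exact hA
  have h2 : Real.exp (n * Real.binEntropy ((w:ℝ)/n) + w * Real.log Q) / (n + 1) ≤ M := by
    refine le_trans ?_ hM
    rw [Real.exp_add, Real.exp_nat_mul (Real.log Q), Real.exp_log (by linarith)]
    have := S11.choose_entropy n w hw hwn
    rw [div_le_iff₀ (by positivity)]
    have hq : 0 < Q ^ w := by positivity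
    nlinarith
  refine (quot_le ℓ hℓ hA0 h1 (by positivity) h2).trans ?_
  rw [div_pow, ← Real.exp_nat_mul, ← Real.exp_nat_mul, div_div_eq_mul_div, mul_comm, mul_div_assoc, ← Real.exp_sub, Nat.cast_sub hℓ]
  gcongr
  have hb : (b:ℝ) = n / D := by rw [hn]; push_cast; field_simp
  have : ((ℓ:ℝ) - 1) * (Real.binEntropy ((w:ℝ)/n) + (w:ℝ)/n * Real.log Q) + ℓ * ((w:ℝ)/n * Real.log s - (1 / (D:ℝ)) * Real.log (g s)) = - (ℓ * (b * Real.log (g s) - w * Real.log s) - ((ℓ:ℝ) - (1:ℕ)) * (n * Real.binEntropy ((w:ℝ)/n) + w * Real.log Q)) / n := by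
    rw [hb]
    push_cast
    field_simp
    ring
  rw [this, le_div_iff₀ hn'] at hc
  linarith

lemma compact_c (γ β : ℝ) (hγ : 0 < γ) (f : ℝ → ℝ → ℝ) (hf : ∀ s, Continuous (fun δ => f δ s))
    (hpos : ∀ δ, 0 < δ → δ ≤ β → ∃ s, 0 < s ∧ 0 < f δ s) :
    ∃ c, 0 < c ∧ ∀ δ ∈ Set.Icc γ β, ∃ s, 0 < s ∧ c ≤ f δ s := by
  refine (isCompact_Icc (a := γ) (b := β)).induction_on (p := fun S => ∃ c, 0 < c ∧ ∀ δ ∈ S, ∃ s, 0 < s ∧ c ≤ f δ s) ?_ ?_ ?_ ?_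
  · exact ⟨1, one_pos, by simp⟩
  · rintro S S' h ⟨c, hc, h'⟩
    exact ⟨c, hc, fun δ hδ => h' δ (h hδ)⟩
  · rintro S S' ⟨c, hc, h⟩ ⟨c', hc', h'⟩
    refine ⟨min c c', lt_min hc hc', ?_⟩
    rintro δ (hδ | hδ)
    · obtain ⟨s, hs, h⟩ := h δ hδ
      exact ⟨s, hs, (min_le_left _ _).trans h⟩
    · obtain ⟨s, hs, h⟩ := h' δ hδ
      exact ⟨s, hs, (min_le_right _ _).trans h⟩
  · intro δ hδ
    obtain ⟨s, hs, h⟩ := hpos δ (hγ.trans_le hδ.1) hδ.2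
    refine ⟨{x | f δ s / 2 < f x s}, ?_, f δ s / 2, by linarith, fun x hx => ⟨s, hs, le_of_lt hx⟩⟩
    apply mem_nhdsWithin_of_mem_nhds
    exact (hf s).continuousAt.eventually_const_lt (by linarith)

lemma exp_tend (ℓ D : ℕ) (hD : 1 ≤ D) (c : ℝ) (hc : 0 < c) :
    Filter.Tendsto (fun b : ℕ => (((b * D : ℕ) : ℝ) + 1) ^ ℓ * Real.exp (- c * ((b * D : ℕ) : ℝ))) Filter.atTop (nhds 0) := by
  have h0 := Real.tendsto_pow_mul_exp_neg_atTop_nhds_zero ℓ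
  have h1 : Filter.Tendsto (fun b : ℕ => c * (((b * D : ℕ) : ℝ) + 1)) Filter.atTop Filter.atTop := by
    apply Filter.Tendsto.const_mul_atTop hc
    apply Filter.tendsto_atTop_add_const_right
    refine tendsto_natCast_atTop_atTop.comp ?_
    exact Filter.tendsto_id.atTop_mul_const' (by omega)
  have h2 := (h0.comp h1).const_mul ((c ^ ℓ)⁻¹ * Real.exp c)
  rw [mul_zero] at h2
  refine h2.congr ?_
  intro b
  simp only [Function.comp]
  rw [mul_pow, show -(c * (((b * D : ℕ) : ℝ) + 1)) = -c * ((b * D : ℕ) : ℝ) + -c by ring, Real.exp_add, Real.exp_neg c]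
  field_simp

lemma sum_tendsto (D d ℓ : ℕ) (hD : 1 ≤ D) (hd : 1 ≤ d) (hℓ : 1 ≤ ℓ) (K Q β : ℝ) (hK : 0 ≤ K)
    (hη : 0 < (ℓ:ℝ) - 1 - ℓ / d) (hβ : β < 1)
    (hQ : 1 ≤ Q) (g : ℝ → ℝ) (hg1 : ∀ s, 0 < s → 1 ≤ g s) (hg2 : ∀ s, 0 < s → s ≤ 1 → g s ≤ 1 + K * s ^ d)
    (A M : ℕ → ℕ → ℝ)
    (hA0 : ∀ b w, 0 ≤ A b w) (hA : ∀ b w s, 0 < s → A b w * s ^ w ≤ g s ^ b)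
    (hM : ∀ b w, ((b * D).choose w : ℝ) * Q ^ w ≤ M b w)
    (hpos : ∀ δ, 0 < δ → δ ≤ β → ∃ s, 0 < s ∧ 0 < ((ℓ:ℝ) - 1) * (Real.binEntropy δ + δ * Real.log Q) + ℓ * (δ * Real.log s - (1 / (D:ℝ)) * Real.log (g s))) :
    Filter.Tendsto (fun b : ℕ => ∑ w ∈ (range (b * D + 1)).filter (fun w : ℕ => 1 ≤ w ∧ (w:ℝ) < β * ((b * D : ℕ) : ℝ)),
      M b w * (A b w / M b w) ^ ℓ) Filter.atTop (nhds 0) := by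
  set η := (ℓ:ℝ) - 1 - ℓ / d with hηd
  set Cs : ℝ := Real.exp K ^ ℓ * 2 ^ (ℓ - 1) with hCs
  have hCs0 : 0 < Cs := by positivity
  obtain ⟨γ, hγ0, hγ2, hγ⟩ : ∃ γ : ℝ, 0 < γ ∧ γ ≤ 1/2 ∧ Cs * γ ^ η ≤ 1/2 := by
    have h1 : Filter.Tendsto (fun x : ℝ => Cs * x ^ η) (nhdsWithin 0 (Set.Ioi 0)) (nhds 0) := by
      have : Filter.Tendsto (fun x : ℝ => Cs * x ^ η) (nhds 0) (nhds (Cs * 0 ^ η)) := by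
        apply Filter.Tendsto.const_mul
        exact (Real.continuousAt_rpow_const 0 η (Or.inr hη.le))
      rw [Real.zero_rpow hη.ne', mul_zero] at this
      exact this.mono_left nhdsWithin_le_nhds
    have h2 := h1.eventually_le_const (show (0:ℝ) < 1/2 by norm_num)
    have h3 : ∀ᶠ x : ℝ in nhdsWithin 0 (Set.Ioi 0), x ∈ Set.Ioc (0:ℝ) (1/2) := Ioc_mem_nhdsGT (by norm_num)
    obtain ⟨γ, h, h'⟩ := (h2.and h3).exists
    exact ⟨γ, h'.1, h'.2, h⟩
  obtain ⟨c, hc, hcs⟩ := compact_c γ β hγ0 (fun δ s => ((ℓ:ℝ) - 1) * (Real.binEntropy δ + δ * Real.log Q) + ℓ * (δ * Real.log s - (1 / (D:ℝ)) * Real.log (g s))) (fun s => by fun_prop) hpos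
  let u : ℕ → ℕ → ℝ := fun b w => if 1 ≤ w ∧ (w:ℝ) ≤ γ * ((b * D : ℕ) : ℝ) then (Cs * ((w:ℝ) / ((b * D : ℕ) : ℝ)) ^ η) ^ w else 0
  have hu0 : ∀ b w, 0 ≤ u b w := by
    intro b w
    simp only [u]
    split_ifs <;> positivity
  have hub : ∀ b w, u b w ≤ (1/2)^w := by
    intro b w
    simp only [u]
    split_ifs with h
    · have hw' : (0:ℝ) < w := by exact_mod_cast h.1
      have hn' : (0:ℝ) < ((b * D : ℕ) : ℝ) := by
        by_contra hh
        have : γ * ((b * D : ℕ) : ℝ) ≤ 0 := mul_nonpos_of_nonneg_of_nonpos hγ0.le (not_lt.mp hh)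
        linarith
      gcongr
      refine le_trans ?_ hγ
      gcongr
      rw [div_le_iff₀ hn']; exact h.2
    · positivity
  have hsum : Summable (fun w : ℕ => ((1:ℝ)/2)^w) := summable_geometric_two
  have hus : ∀ b, Summable (u b) := fun b => Summable.of_nonneg_of_le (hu0 b) (hub b) hsum
  have hnt : Filter.Tendsto (fun b : ℕ => ((b * D : ℕ) : ℝ)) Filter.atTop Filter.atTop := by
    refine tendsto_natCast_atTop_atTop.comp ?_
    exact Filter.tendsto_id.atTop_mul_const' (by omega)
  have hut : Filter.Tendsto (fun b => ∑' w, u b w) Filter.atTop (nhds 0) := by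
    have := tendsto_tsum_of_dominated_convergence (𝓕 := Filter.atTop) (f := u) (g := fun _ => 0) hsum ?_ ?_
    · simpa using this
    · intro w
      rcases Nat.eq_zero_or_pos w with rfl | hw
      · simp [u]
      · refine squeeze_zero (fun b => hu0 b w) (g := fun b => (Cs * ((w:ℝ) / ((b * D : ℕ) : ℝ)) ^ η) ^ w) ?_ ?_
        · intro b
          simp only [u]
          split_ifs
          · exact le_rfl
          · positivity
        · have h1 : Filter.Tendsto (fun b : ℕ => (w:ℝ) / ((b * D : ℕ) : ℝ)) Filter.atTop (nhds 0) := hnt.const_div_atTop _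
          have h2 := (((Real.continuousAt_rpow_const 0 η (Or.inr hη.le)).tendsto.comp h1).const_mul Cs).pow w
          rw [Real.zero_rpow hη.ne', mul_zero, zero_pow hw.ne'] at h2
          exact h2
    · refine Filter.Eventually.of_forall fun b w => ?_
      rw [Real.norm_of_nonneg (hu0 b w)]
      exact hub b w
  have hfin := hut.add (exp_tend ℓ D hD c hc)
  rw [add_zero] at hfin
  have hMnn : ∀ b w, 0 ≤ M b w := fun b w => le_trans (by positivity) (hM b w)
  refine squeeze_zero ?_ ?_ hfin
  · intro b
    apply Finset.sum_nonneg
    intro w _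
    have := hMnn b w
    have := hA0 b w
    positivity
  · intro b
    set n := b * D with hn
    set v : ℝ := ((n:ℝ) + 1) ^ (ℓ - 1) * Real.exp (- c * n) with hv
    have hv0 : 0 ≤ v := by positivity
    calc _ ≤ ∑ w ∈ (range (n + 1)).filter (fun w : ℕ => 1 ≤ w ∧ (w:ℝ) < β * (n : ℝ)), (u b w + v) := by
          apply Finset.sum_le_sum
          intro w hw
          simp only [mem_filter, mem_range] at hw
          obtain ⟨_, hw1, hwβ⟩ := hw
          have hw' : (0:ℝ) < w := by exact_mod_cast hw1
          have hn' : (0:ℝ) < n := by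
            rcases Nat.eq_zero_or_pos n with h | h
            · rw [h] at hwβ; simp at hwβ; linarith
            · exact_mod_cast h
          by_cases hγw : (w:ℝ) ≤ γ * n
          · have e : u b w = (Cs * ((w:ℝ) / (n : ℝ)) ^ η) ^ w := by
              simp only [u]
              rw [if_pos ⟨hw1, hγw⟩]
            rw [e]
            have h2w : 2 * w ≤ n := by
              have : 2 * (w:ℝ) ≤ n := by nlinarith
              exact_mod_cast this
            have := small_term n b D d ℓ w hn hD hd hℓ K Q (A b w) (M b w) hK hQ g hg1 hg2 (hA0 b w) (hA b w) (hM b w) hw1 h2w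
            linarith
          · push Not at hγw
            obtain ⟨s, hs, hcs⟩ := hcs ((w:ℝ)/n) ⟨by rw [le_div_iff₀ hn']; exact hγw.le, by rw [div_le_iff₀ hn']; exact hwβ.le⟩
            have hwn : w < n := by
              have : (w:ℝ) < n := by nlinarith
              exact_mod_cast this
            have := mid_term n b D ℓ w hn hD hℓ Q (A b w) (M b w) c s hQ g hs (hg1 s hs) (hA0 b w) (hA b w s hs) (hM b w) hw1 hwn hcs
            have := hu0 b w
            linarith
      _ ≤ ∑ w ∈ range (n + 1), (u b w + v) := by
          apply Finset.sum_le_sum_of_subset_of_nonneg (Finset.filter_subset _ _)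
          intro w _ _
          have := hu0 b w
          linarith
      _ = ∑ w ∈ range (n + 1), u b w + (n + 1) * v := by
          rw [Finset.sum_add_distrib]; simp
      _ ≤ _ := by
          apply add_le_add
          · exact (hus b).sum_le_tsum _ (fun w _ => hu0 b w)
          · rw [hv, ← mul_assoc, ← pow_succ', Nat.sub_add_cancel hℓ]

lemma ent_upper (t : ℝ) (h0 : 0 < t) (h1 : t < 1) : Real.binEntropy t ≤ - t * Real.log t + t := by
  unfold Real.binEntropy
  have h : 0 < 1 - t := by linarith
  have := Real.log_le_sub_one_of_pos (inv_pos.mpr h)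
  have h2 : (1 - t) * Real.log (1 - t)⁻¹ ≤ (1 - t) * ((1 - t)⁻¹ - 1) := by gcongr
  have h3 : (1 - t) * ((1 - t)⁻¹ - 1) = t := by field_simp; ring
  rw [Real.log_inv t]
  linarith

lemma ent_lower (t : ℝ) (h0 : 0 < t) (h1 : t < 1) : - t * Real.log t + t * (1 - t) ≤ Real.binEntropy t := by
  unfold Real.binEntropy
  have h : 0 < 1 - t := by linarith
  have := Real.log_le_sub_one_of_pos h
  rw [Real.log_inv t, Real.log_inv]
  nlinarith

lemma sup_upper (D d : ℕ) (hD : 1 ≤ D) (hd : 1 ≤ d) (A δ t s G : ℝ) (hA : 0 < A) (ht : t = δ * D / d)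
    (ht0 : 0 < t) (ht1 : t < 1) (hs : 0 < s) (hG : 1 + A * s ^ d ≤ G) :
    δ * Real.log s - (1 / (D:ℝ)) * Real.log G ≤ - (1 / (D:ℝ)) * (Real.binEntropy t + t * Real.log A) := by
  have hD' : (0:ℝ) < D := by exact_mod_cast hD
  have hd' : (0:ℝ) < d := by exact_mod_cast hd
  have hu : 0 < s ^ d := by positivity
  have h1t : 0 < 1 - t := by linarith
  have h1 : Real.log (1 + A * s ^ d) ≤ Real.log G := Real.log_le_log (by positivity) hG
  have h2 := strictConcaveOn_log_Ioi.concaveOn.2 (x := A * s ^ d / t) (y := (1 - t)⁻¹)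
    (Set.mem_Ioi.mpr (by positivity)) (Set.mem_Ioi.mpr (by positivity)) ht0.le h1t.le (by ring)
  simp only [smul_eq_mul] at h2
  rw [mul_div_cancel₀ _ ht0.ne', mul_inv_cancel₀ h1t.ne', Real.log_div (by positivity) (by positivity), Real.log_mul (by positivity) (by positivity), Real.log_pow] at h2
  have e : δ = t * d / D := by rw [ht]; field_simp
  unfold Real.binEntropy
  rw [Real.log_inv t]
  rw [add_comm (A * s ^ d)] at h2
  have h3 := h2.trans h1
  rw [e]
  have : t * d / D * Real.log s - (1 / (D:ℝ)) * Real.log G - (- (1 / (D:ℝ)) * (t * -Real.log t + (1 - t) * Real.log (1 - t)⁻¹ + t * Real.log A)) = (t * (Real.log A + d * Real.log s - Real.log t) + (1 - t) * Real.log (1 - t)⁻¹ - Real.log G) / D := by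
    field_simp
    ring
  have h4 : (t * (Real.log A + d * Real.log s - Real.log t) + (1 - t) * Real.log (1 - t)⁻¹ - Real.log G) / D ≤ 0 := by
    apply div_nonpos_of_nonpos_of_nonneg _ hD'.le
    linarith
  linarith

lemma contra_one (D ℓ : ℕ) (hD : 1 ≤ D) (hℓ : 2 ≤ ℓ) (Q : ℝ) (hQ : 1 ≤ Q) (g : ℝ → ℝ)
    (hg : ∀ s, 0 < s → 1 + (D : ℝ) * Q * s ≤ g s) (δ3 : ℝ) (hδ3 : 0 < δ3) :
    ∃ δ, 0 < δ ∧ δ < δ3 ∧ ∀ s, 0 < s → ((ℓ:ℝ) - 1) * (Real.binEntropy δ + δ * Real.log Q) + ℓ * (δ * Real.log s - (1 / (D:ℝ)) * Real.log (g s)) ≤ 0 := by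
  have hD' : (1:ℝ) ≤ D := by exact_mod_cast hD
  have hℓ' : (2:ℝ) ≤ ℓ := by exact_mod_cast hℓ
  obtain ⟨δ, h0, h1, h2, h3⟩ : ∃ δ : ℝ, 0 < δ ∧ δ ≤ δ3 / 2 ∧ δ ≤ Real.exp (-ℓ) ∧ δ ≤ 1 / (2 * D) :=
    ⟨min (δ3/2) (min (Real.exp (-ℓ)) (1/(2*D))), by positivity, by simp, by simp, by simp⟩
  have hδD : δ * D ≤ 1/2 := by
    rw [le_div_iff₀ (by positivity)] at h3; linarith
  refine ⟨δ, h0, by linarith, ?_⟩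
  intro s hs
  have ht0 : 0 < δ * D := by positivity
  have a := sup_upper D 1 hD le_rfl (D * Q) δ (δ * D) s (g s) (by positivity) (by simp) ht0 (by linarith) hs (by simpa using hg s hs)
  have b := ent_lower (δ * D) ht0 (by linarith)
  have c := ent_upper δ h0 (by nlinarith)
  have l : Real.log δ ≤ -ℓ := by
    have := Real.log_le_log h0 h2
    rwa [Real.log_exp] at this
  have L : 0 ≤ Real.log Q := Real.log_nonneg hQ
  rw [Real.log_mul (by positivity) (by positivity)] at a b
  have a' : δ * Real.log s - (1 / (D:ℝ)) * Real.log (g s) ≤ - (δ * (-Real.log δ + (1 - δ * D) + Real.log Q)) := by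
    refine a.trans ?_
    have : (1 / (D:ℝ)) * (-(δ * D) * (Real.log δ + Real.log D) + δ * D * (1 - δ * D) + δ * D * (Real.log D + Real.log Q)) ≤ (1 / (D:ℝ)) * (Real.binEntropy (δ * D) + δ * D * (Real.log D + Real.log Q)) := by
      gcongr
    have e : (1 / (D:ℝ)) * (-(δ * D) * (Real.log δ + Real.log D) + δ * D * (1 - δ * D) + δ * D * (Real.log D + Real.log Q)) = δ * (-Real.log δ + (1 - δ * D) + Real.log Q) := by
      field_simp; ring
    linarith
  have k1 : ((ℓ:ℝ) - 1) * (Real.binEntropy δ + δ * Real.log Q) ≤ ((ℓ:ℝ) - 1) * ((- δ * Real.log δ + δ) + δ * Real.log Q) := by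
    have : 0 ≤ (ℓ:ℝ) - 1 := by linarith
    gcongr
  have k2 : (ℓ:ℝ) * (δ * Real.log s - (1 / (D:ℝ)) * Real.log (g s)) ≤ ℓ * (- (δ * (-Real.log δ + (1 - δ * D) + Real.log Q))) := by gcongr
  have k3 : ((ℓ:ℝ) - 1) * ((- δ * Real.log δ + δ) + δ * Real.log Q) + ℓ * (- (δ * (-Real.log δ + (1 - δ * D) + Real.log Q))) = δ * (Real.log δ + (ℓ - 1) - ℓ * (1 - δ * D) - Real.log Q) := by ring
  have k4 : δ * (Real.log δ + (ℓ - 1) - ℓ * (1 - δ * D) - Real.log Q) ≤ 0 := by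
    apply mul_nonpos_of_nonneg_of_nonpos h0.le
    nlinarith
  linarith

lemma contra_two (D : ℕ) (hD : 2 ≤ D) (Q : ℝ) (hQ : 1 ≤ Q) (g : ℝ → ℝ)
    (hg : ∀ s, 0 < s → 1 + (D.choose 2 : ℝ) * Q * s ^ 2 ≤ g s) (δ3 : ℝ) (hδ3 : 0 < δ3) :
    ∃ δ, 0 < δ ∧ δ < δ3 ∧ ∀ s, 0 < s → ((2:ℝ) - 1) * (Real.binEntropy δ + δ * Real.log Q) + 2 * (δ * Real.log s - (1 / (D:ℝ)) * Real.log (g s)) ≤ 0 := by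
  have hD' : (2:ℝ) ≤ D := by exact_mod_cast hD
  obtain ⟨δ, h0, h1, h3⟩ : ∃ δ : ℝ, 0 < δ ∧ δ ≤ δ3 / 2 ∧ δ ≤ 1 / D :=
    ⟨min (δ3/2) (1/D), by positivity, by simp, by simp⟩
  have hδD : δ * D ≤ 1 := by
    rw [le_div_iff₀ (by positivity)] at h3; linarith
  refine ⟨δ, h0, by linarith, ?_⟩
  intro s hs
  have ht0 : 0 < δ * D / 2 := by positivity
  have hch : (D.choose 2 : ℝ) = D * (D - 1) / 2 := Nat.cast_choose_two ℝ D
  have hch0 : (0:ℝ) < D.choose 2 := by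
    rw [hch]
    have : (0:ℝ) < D - 1 := by linarith
    positivity
  have a := sup_upper D 2 (by omega) (by omega) (D.choose 2 * Q) δ (δ * D / 2) s (g s) (by positivity) (by simp) ht0 (by linarith) hs (by simpa using hg s hs)
  rcases Nat.lt_or_ge 2 D with hD3 | hD2
  · have hD3' : (3:ℝ) ≤ D := by exact_mod_cast hD3
    have b := ent_lower (δ * D / 2) ht0 (by linarith)
    have c := ent_upper δ h0 (by nlinarith)
    have hD1 : (0:ℝ) < D - 1 := by linarith
    have e1 : Real.log (δ * D / 2) = Real.log δ + Real.log (D / 2) := by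
      rw [mul_div_assoc, Real.log_mul (by positivity) (by positivity)]
    have e2 : Real.log (D.choose 2 * Q) = Real.log (D / 2) + Real.log (D - 1) + Real.log Q := by
      rw [hch, Real.log_mul (by positivity) (by positivity), show (D:ℝ) * (D - 1) / 2 = D / 2 * (D - 1) by ring, Real.log_mul (by positivity) (by positivity)]
    rw [e1] at b
    rw [e2] at a
    have hl : Real.log 2 ≤ Real.log (D - 1) := Real.log_le_log (by norm_num) (by linarith)
    have hl2 := Real.log_two_gt_d9
    have a' : δ * Real.log s - (1 / (D:ℝ)) * Real.log (g s) ≤ - (δ / 2 * (-Real.log δ + (1 - δ * D / 2) + Real.log (D - 1) + Real.log Q)) := by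
      refine a.trans ?_
      have : (1 / (D:ℝ)) * (-(δ * D / 2) * (Real.log δ + Real.log (D / 2)) + δ * D / 2 * (1 - δ * D / 2) + δ * D / 2 * (Real.log (D / 2) + Real.log (D - 1) + Real.log Q)) ≤ (1 / (D:ℝ)) * (Real.binEntropy (δ * D / 2) + δ * D / 2 * (Real.log (D / 2) + Real.log (D - 1) + Real.log Q)) := by
        gcongr
      have e : (1 / (D:ℝ)) * (-(δ * D / 2) * (Real.log δ + Real.log (D / 2)) + δ * D / 2 * (1 - δ * D / 2) + δ * D / 2 * (Real.log (D / 2) + Real.log (D - 1) + Real.log Q)) = δ / 2 * (-Real.log δ + (1 - δ * D / 2) + Real.log (D - 1) + Real.log Q) := by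
        field_simp; ring
      linarith
    have k4 : δ * (δ * D / 2 - Real.log (D - 1)) ≤ 0 := by
      apply mul_nonpos_of_nonneg_of_nonpos h0.le
      linarith
    nlinarith
  · have : D = 2 := by omega
    subst this
    norm_num at a ⊢
    linarith
end S11


/-- Let q be a prime power, let C0 = RS(Δ0,k0) be a Reed–Solomon code over F_q
with weight enumerator g0(s), and let ℓ ≥ 2.  Define
F3(δ) = (ℓ−1)·( h_q(δ) + δ·log_q(q−1) ) + ℓ·sup_{s>0}( δ·log_q(s) − (1/Δ0)·log_q(g0(s)) ).
Suppose δ3 ∈ (0,1) satisfies F3(δ3) = 0 and F3(δ) > 0 for all δ ∈ (0,δ3).  Then for every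
ε ∈ (0,δ3), the fraction of ℓ-tuples (π1,c1,…,πℓ,cℓ) indexing the ℓ-layer ensemble E3(Δ0,b)
(with n = bΔ0) whose code has minimum distance at least (δ3 − ε)·n tends to 1 as b → ∞. -/
theorem statement_11 (q Δ0 k0 ℓ : ℕ) (hq : IsPrimePow q) (hℓ : 2 ≤ ℓ)
    (F : Type) [Field F] [Fintype F] [DecidableEq F] (hF : Fintype.card F = q)
    (hk0 : 1 ≤ k0) (hk0' : k0 ≤ Δ0) (hΔ0q : Δ0 ≤ q)
    (α : Fin Δ0 → F) (hα : Function.Injective α)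
    (C0 : Set (Fin Δ0 → F))
    (hC0 : C0 = {y | ∃ p : Polynomial F, p.degree < (k0 : ℕ) ∧ ∀ j, y j = p.eval (α j)})
    (g0 : ℝ → ℝ) (hg0 : ∀ s : ℝ, g0 s = ∑ᶠ y ∈ C0, s ^ hammingNorm y)
    (F3 : ℝ → ℝ)
    (hF3 : ∀ δ : ℝ, F3 δ =
      ((ℓ : ℝ) - 1) *
        ((-δ * Real.logb q δ - (1 - δ) * Real.logb q (1 - δ)) + δ * Real.logb q ((q : ℝ) - 1))
        + (ℓ : ℝ) * sSup {x : ℝ | ∃ s : ℝ, 0 < s ∧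
            x = δ * Real.logb q s - (1 / (Δ0 : ℝ)) * Real.logb q (g0 s)})
    (δ3 : ℝ) (hδ3 : 0 < δ3) (hδ3' : δ3 < 1)
    (hroot : F3 δ3 = 0) (hpos : ∀ δ : ℝ, 0 < δ → δ < δ3 → 0 < F3 δ)
    (ε : ℝ) (hε : 0 < ε) (hεδ : ε < δ3) :
    Filter.Tendsto (fun b : ℕ =>
      (Nat.card {t : Fin ℓ →
            Equiv.Perm (Fin b × Fin Δ0) × {c : Fin b × Fin Δ0 → F // ∀ j, c j ≠ 0} //
          ∀ x : Fin b × Fin Δ0 → F,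
            (∀ l : Fin ℓ, ∀ i : Fin b,
              (fun j => ((t l).2 : Fin b × Fin Δ0 → F) (i, j) * x ((t l).1 (i, j))) ∈ C0) →
            x ≠ 0 → (δ3 - ε) * ((b * Δ0 : ℕ) : ℝ) ≤ (hammingNorm x : ℝ)} : ℝ)
        / (Nat.card (Fin ℓ →
            Equiv.Perm (Fin b × Fin Δ0) × {c : Fin b × Fin Δ0 → F // ∀ j, c j ≠ 0}) : ℝ))
      Filter.atTop (nhds 1) := by
  classical
  have hq2 : 2 ≤ q := hq.two_le
  have hq2' : (2:ℝ) ≤ q := by exact_mod_cast hq2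
  have hD : 1 ≤ Δ0 := hk0.trans hk0'
  have hlq : 0 < Real.log q := Real.log_pos (by linarith)
  have hQ : (1:ℝ) ≤ (q:ℝ) - 1 := by linarith
  have hℓ' : (2:ℝ) ≤ ℓ := by exact_mod_cast hℓ
  set d := Δ0 - k0 + 1 with hd
  have hup : ∀ s, 0 < s → s ≤ 1 → g0 s ≤ 1 + (q:ℝ) ^ Δ0 * s ^ d := by
    intro s hs hs1
    rw [hg0, hC0, ← hF]
    exact S11.g_upper hk0 hk0' α hα s hs hs1
  have hlow : ∀ s, 0 < s → 1 + (Δ0.choose d : ℝ) * ((q:ℝ) - 1) * s ^ d ≤ g0 s := by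
    intro s hs
    rw [hg0, hC0, ← hF]
    exact S11.g_lower hk0 hk0' α hα s hs
  have hg1 : ∀ s, 0 < s → 1 ≤ g0 s := by
    intro s hs
    have h1 := hlow s hs
    have h0 : (0:ℝ) ≤ (q:ℝ) - 1 := by linarith
    have : 0 ≤ (Δ0.choose d : ℝ) * ((q:ℝ) - 1) * s ^ d := by positivity
    linarith
  have hex : ∀ δ, 0 < δ → δ < δ3 → ∃ s, 0 < s ∧ 0 < ((ℓ:ℝ) - 1) * (Real.binEntropy δ + δ * Real.log ((q:ℝ) - 1)) + ℓ * (δ * Real.log s - (1 / (Δ0:ℝ)) * Real.log (g0 s)) := by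
    intro δ h0 h1
    have h := hpos δ h0 h1
    rw [hF3] at h
    set H := ((ℓ : ℝ) - 1) * ((-δ * Real.logb q δ - (1 - δ) * Real.logb q (1 - δ)) + δ * Real.logb q ((q : ℝ) - 1)) with hH
    have h2 : -H / ℓ < sSup {x : ℝ | ∃ s : ℝ, 0 < s ∧ x = δ * Real.logb q s - (1 / (Δ0 : ℝ)) * Real.logb q (g0 s)} := by
      rw [div_lt_iff₀ (by linarith)]
      linarith
    have hne : {x : ℝ | ∃ s : ℝ, 0 < s ∧ x = δ * Real.logb q s - (1 / (Δ0 : ℝ)) * Real.logb q (g0 s)}.Nonempty :=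
      ⟨δ * Real.logb q 1 - (1 / (Δ0 : ℝ)) * Real.logb q (g0 1), 1, one_pos, rfl⟩
    obtain ⟨x, ⟨s, hs, rfl⟩, hx⟩ := exists_lt_of_lt_csSup hne h2
    refine ⟨s, hs, ?_⟩
    rw [div_lt_iff₀ (by linarith)] at hx
    have h3 : 0 < (H + (δ * Real.logb q s - (1 / (Δ0 : ℝ)) * Real.logb q (g0 s)) * ℓ) * Real.log q := mul_pos (by linarith) hlq
    have e : (H + (δ * Real.logb q s - (1 / (Δ0 : ℝ)) * Real.logb q (g0 s)) * ℓ) * Real.log q = ((ℓ:ℝ) - 1) * (Real.binEntropy δ + δ * Real.log ((q:ℝ) - 1)) + ℓ * (δ * Real.log s - (1 / (Δ0:ℝ)) * Real.log (g0 s)) := by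
      rw [hH]
      unfold Real.binEntropy
      simp only [Real.logb, Real.log_inv]
      have hD' : (0:ℝ) < Δ0 := by exact_mod_cast hD
      field_simp
      ring
    linarith
  have hη : 0 < (ℓ:ℝ) - 1 - ℓ / d := by
    by_cases hd1 : d = 1
    · exfalso
      rw [hd1] at hlow
      obtain ⟨δ, h0, h1, h⟩ := S11.contra_one Δ0 ℓ hD hℓ ((q:ℝ) - 1) hQ g0 (by simpa using hlow) δ3 hδ3
      obtain ⟨s, hs, h'⟩ := hex δ h0 h1
      exact absurd (h s hs) (not_le.mpr h')
    by_cases hd2 : d = 2 ∧ ℓ = 2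
    · exfalso
      obtain ⟨hd2, hl2⟩ := hd2
      rw [hd2] at hlow
      obtain ⟨δ, h0, h1, h⟩ := S11.contra_two Δ0 (by omega) ((q:ℝ) - 1) hQ g0 hlow δ3 hδ3
      obtain ⟨s, hs, h'⟩ := hex δ h0 h1
      rw [hl2] at h'
      exact absurd (h s hs) (not_le.mpr (by exact_mod_cast h'))
    have hd0 : (0:ℝ) < d := by exact_mod_cast (by omega : 0 < d)
    rw [sub_pos, div_lt_iff₀ hd0]
    have hd2' : (2:ℝ) ≤ d := by exact_mod_cast (by omega : 2 ≤ d)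
    rcases Nat.lt_or_ge 2 d with h | h
    · have : (3:ℝ) ≤ d := by exact_mod_cast h
      nlinarith
    · have : (3:ℝ) ≤ ℓ := by exact_mod_cast (by omega : 3 ≤ ℓ)
      nlinarith
  let B : ∀ b : ℕ, Set (Fin b × Fin Δ0 → F) := fun b => {y | ∀ i, (fun j => y (i, j)) ∈ C0}
  have hS := S11.sum_tendsto Δ0 d ℓ hD (by omega) (by omega) ((q:ℝ) ^ Δ0) ((q:ℝ) - 1) (δ3 - ε) (by positivity) hη (by linarith)
    hQ g0 hg1 hup (fun b w => (S11.W (B b) w : ℝ)) (fun b w => (S11.W (Set.univ : Set (Fin b × Fin Δ0 → F)) w : ℝ))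
    (fun b w => by positivity)
    (fun b w s hs => S11.W_gen b Δ0 C0 g0 hg0 s hs w)
    (fun b w => by
      have := S11.W_mono (ι := Fin b × Fin Δ0) (F := F) w
      rw [hF] at this
      have h2 : (((Fintype.card (Fin b × Fin Δ0)).choose w * (q - 1) ^ w : ℕ) : ℝ) ≤ (S11.W (Set.univ : Set (Fin b × Fin Δ0 → F)) w : ℝ) := by exact_mod_cast this
      push_cast [Nat.cast_sub (by omega : 1 ≤ q)] at h2
      simpa using h2)
    (fun δ h0 h1 => hex δ h0 (by linarith))
  have hlim := hS.const_sub 1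
  rw [sub_zero] at hlim
  refine tendsto_of_tendsto_of_tendsto_of_le_of_le hlim tendsto_const_nhds ?_ ?_
  · intro b
    have := S11.union_bound (B b) ℓ ((δ3 - ε) * ((b * Δ0 : ℕ) : ℝ))
    have hc : Fintype.card (Fin b × Fin Δ0) = b * Δ0 := by simp
    rw [hc] at this
    exact this
  · intro b
    apply div_le_one_of_le₀ _ (by positivity)
    exact Nat.cast_le.mpr (Finite.card_subtype_le _)
end

section
/- Let q be a prime power, let C_b ⊆ F_q^n be a linear code (the base code), and let ℓ ≥ 1 be an integer. Consider the ℓ-layer ensemble of codes C(π1,c1,…,πℓ,cℓ) = {x ∈ F_q^n : φ_{πi,ci}(x) ∈ C_b for all i = 1,…,ℓ}, indexed by all (n!·(q−1)^n)^ℓ tuples of permutations πi of {1,…,n} and vectors ci ∈ (F_q∖{0})^n. Then for every W with 0 ≤ W ≤ n, the average over all tuples of #{x ∈ C(π1,c1,…,πℓ,cℓ) : wt(x) = W} equals A(W)^ℓ / ((q−1)^W · binom(n,W))^{ℓ−1}, where A(W) = #{y ∈ C_b : wt(y) = W}. -/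
section aux12
variable {n : ℕ} {F : Type} [Field F] [Fintype F] [DecidableEq F]

abbrev TT12 (n : ℕ) (F : Type) [Field F] := Equiv.Perm (Fin n) × {c : Fin n → F // ∀ j, c j ≠ 0}

def phi12 (t : TT12 n F) (x : Fin n → F) : Fin n → F := fun j => (t.2 : Fin n → F) j * x (t.1 j)


lemma norm_phi12 (t : TT12 n F) (x : Fin n → F) : hammingNorm (phi12 t x) = hammingNorm x := by
  unfold hammingNorm phi12
  refine Finset.card_bij (fun j _ => t.1 j) ?_ ?_ ?_
  · intro a ha
    simp at ha ⊢
    exact ha.2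
  · intro a _ b _ h
    exact t.1.injective h
  · intro b hb
    refine ⟨t.1.symm b, ?_, by simp⟩
    simp at hb ⊢
    exact ⟨t.2.2 _, hb⟩


lemma bij_phi12 (t : TT12 n F) : Function.Bijective (phi12 t) := by
  constructor
  · intro x y h
    funext i
    have := congrFun h (t.1.symm i)
    simp only [phi12, Equiv.apply_symm_apply] at this
    exact mul_left_cancel₀ (t.2.2 _) this
  · intro y
    refine ⟨fun i => ((t.2 : Fin n → F) (t.1.symm i))⁻¹ * y (t.1.symm i), ?_⟩
    funext j
    simp only [phi12, Equiv.symm_apply_apply]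
    rw [mul_inv_cancel_left₀ (t.2.2 j)]


lemma trans_phi12 (x y : Fin n → F) (h : hammingNorm x = hammingNorm y) :
    ∃ t : TT12 n F, phi12 t x = y := by
  have hc : Fintype.card {j // y j ≠ 0} = Fintype.card {j // x j ≠ 0} := by
    rw [Fintype.card_subtype, Fintype.card_subtype]
    exact h.symm
  let e := (Fintype.equivOfCardEq hc)
  let p : Equiv.Perm (Fin n) := e.extendSubtype
  have hp : ∀ j, y j ≠ 0 → x (p j) ≠ 0 := fun j hj => e.extendSubtype_mem j hj
  have hp' : ∀ j, y j = 0 → x (p j) = 0 := fun j hj => by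
    have := e.extendSubtype_not_mem j (by simpa using hj)
    simpa using this
  refine ⟨⟨p, ⟨fun j => if y j = 0 then 1 else y j / x (p j), ?_⟩⟩, ?_⟩
  · intro j
    dsimp only
    split_ifs with hj
    · exact one_ne_zero
    · exact div_ne_zero hj (hp j hj)
  · funext j
    simp only [phi12]
    split_ifs with hj
    · rw [hp' j hj, hj, mul_zero]
    · exact div_mul_cancel₀ _ (hp j hj)

def comp12 (t s : TT12 n F) : TT12 n F :=
  ⟨t.1.trans s.1, ⟨fun j => (t.2 : Fin n → F) j * (s.2 : Fin n → F) (t.1 j),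
    fun j => mul_ne_zero (t.2.2 j) (s.2.2 _)⟩⟩

open Classical in
lemma g_le12 (P : (Fin n → F) → Prop) (s : TT12 n F) (x : Fin n → F) :
    (Finset.univ.filter (fun t : TT12 n F => P (phi12 t (phi12 s x)))).card ≤
    (Finset.univ.filter (fun t : TT12 n F => P (phi12 t x))).card := by
  refine Finset.card_le_card_of_injOn (fun t => comp12 t s) ?_ ?_
  · intro t ht
    simp only [Finset.coe_filter, Finset.mem_univ, true_and, Set.mem_setOf_eq] at ht ⊢
    have : phi12 (comp12 t s) x = phi12 t (phi12 s x) := by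
      funext j
      simp [phi12, comp12, mul_assoc]
    rw [this]
    exact ht
  · intro t _ t' _ h
    simp only [comp12, Prod.mk.injEq, Subtype.mk.injEq] at h
    have h1 : t.1 = t'.1 := by
      ext j
      have := congrArg (fun e => e j) h.1
      simp at this
      rw [this]
    refine Prod.ext h1 (Subtype.ext ?_)
    funext j
    have := congrFun h.2 j
    rw [h1] at this
    exact mul_right_cancel₀ (s.2.2 _) this

open Classical in
lemma g_eq12 (P : (Fin n → F) → Prop) (x y : Fin n → F) (h : hammingNorm x = hammingNorm y) :
    (Finset.univ.filter (fun t : TT12 n F => P (phi12 t x))).card =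
    (Finset.univ.filter (fun t : TT12 n F => P (phi12 t y))).card := by
  obtain ⟨s, hs⟩ := trans_phi12 x y h
  obtain ⟨s', hs'⟩ := trans_phi12 y x h.symm
  apply le_antisymm
  · have := g_le12 P s' y
    rwa [hs'] at this
  · have := g_le12 P s x
    rwa [hs] at this

lemma cardS12 (W : ℕ) : (Finset.univ.filter (fun x : Fin n → F => hammingNorm x = W)).card =
    (Fintype.card F - 1) ^ W * n.choose W := by
  have h1 := Finset.card_eq_sum_card_fiberwise
    (f := fun x : Fin n → F => Finset.univ.filter (fun i => x i ≠ 0))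
    (s := Finset.univ.filter (fun x : Fin n → F => hammingNorm x = W))
    (t := Finset.powersetCard W Finset.univ) (by
      intro x hx
      simp [hammingNorm] at hx ⊢
      exact hx)
  rw [h1, Finset.sum_congr rfl (g := fun _ => (Fintype.card F - 1) ^ W)]
  · simp [mul_comm]
  · intro s hs
    have hs := (Finset.mem_powersetCard.1 hs).2
    have : ({x ∈ Finset.univ.filter (fun x : Fin n → F => hammingNorm x = W) |
        Finset.univ.filter (fun i => x i ≠ 0) = s}) =
        Fintype.piFinset (fun i => if i ∈ s then ({0}ᶜ : Finset F) else {0}) := by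
      ext x
      simp only [Finset.mem_filter, Finset.mem_univ, true_and, Fintype.mem_piFinset]
      constructor
      · rintro ⟨_, h⟩ i
        subst h
        by_cases hi : x i = 0 <;> simp [hi]
      · intro h
        have h2 : Finset.univ.filter (fun i => x i ≠ 0) = s := by
          ext i
          have := h i
          by_cases hi : i ∈ s <;> simp [hi] at this ⊢ <;> exact this
        refine ⟨?_, h2⟩
        unfold hammingNorm
        rw [h2, hs]
    rw [this, Fintype.card_piFinset]
    have : ∀ i, (if i ∈ s then ({0}ᶜ : Finset F) else {0}).card =
        if i ∈ s then Fintype.card F - 1 else 1 := by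
      intro i
      split_ifs <;> simp [Finset.card_compl]
    simp [this, Finset.prod_ite, hs]

lemma cardT12 : Fintype.card (TT12 n F) = n.factorial * (Fintype.card F - 1) ^ n := by
  rw [Fintype.card_prod, Fintype.card_perm, Fintype.card_fin]
  congr 1
  rw [Fintype.card_subtype]
  have : (Finset.univ.filter (fun c : Fin n → F => ∀ j, c j ≠ 0)) =
      Fintype.piFinset (fun _ => ({0}ᶜ : Finset F)) := by
    ext c; simp
  rw [this, Fintype.card_piFinset]
  simp [Finset.card_compl]

open Classical in
lemma double12 (P : (Fin n → F) → Prop) (W : ℕ) :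
    ∑ x ∈ Finset.univ.filter (fun x : Fin n → F => hammingNorm x = W),
      (Finset.univ.filter (fun t : TT12 n F => P (phi12 t x))).card =
    Fintype.card (TT12 n F) *
      (Finset.univ.filter (fun y : Fin n → F => P y ∧ hammingNorm y = W)).card := by
  simp_rw [Finset.card_filter _ (Finset.univ : Finset (TT12 n F))]
  rw [Finset.sum_comm, Finset.sum_congr rfl (g := fun _ =>
    (Finset.univ.filter (fun y : Fin n → F => P y ∧ hammingNorm y = W)).card)]
  · simp
  · intro t _
    rw [← Finset.card_filter]
    refine Finset.card_bij (fun x _ => phi12 t x) ?_ ?_ ?_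
    · intro x hx
      simp at hx ⊢
      exact ⟨hx.2, by rw [norm_phi12, hx.1]⟩
    · intro a _ b _ h
      exact (bij_phi12 t).1 h
    · intro y hy
      obtain ⟨x, rfl⟩ := (bij_phi12 t).2 y
      simp at hy
      refine ⟨x, ?_, rfl⟩
      simp
      exact ⟨by rw [← hy.2, norm_phi12], hy.1⟩

open Classical in
lemma tuples12 (P : (Fin n → F) → Prop) (W ℓ : ℕ) :
    ∑ t : Fin ℓ → TT12 n F, Nat.card {x : Fin n → F // (∀ i, P (phi12 (t i) x)) ∧ hammingNorm x = W}
    = ∑ x ∈ Finset.univ.filter (fun x : Fin n → F => hammingNorm x = W),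
      (Finset.univ.filter (fun t : TT12 n F => P (phi12 t x))).card ^ ℓ := by
  have h1 : ∀ t : Fin ℓ → TT12 n F,
      Nat.card {x : Fin n → F // (∀ i, P (phi12 (t i) x)) ∧ hammingNorm x = W} =
      ∑ x ∈ Finset.univ.filter (fun x : Fin n → F => hammingNorm x = W),
        if (∀ i, P (phi12 (t i) x)) then 1 else 0 := by
    intro t
    rw [Nat.card_eq_fintype_card, Fintype.card_subtype, ← Finset.card_filter,
      Finset.filter_filter]
    congr 1
    ext x
    simp [and_comm]
  simp_rw [h1]
  rw [Finset.sum_comm]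
  refine Finset.sum_congr rfl fun x _ => ?_
  rw [← Finset.card_filter]
  have : (Finset.univ.filter (fun t : Fin ℓ → TT12 n F => ∀ i, P (phi12 (t i) x))) =
      Fintype.piFinset (fun _ => Finset.univ.filter (fun t : TT12 n F => P (phi12 t x))) := by
    ext t; simp
  rw [this, Fintype.card_piFinset]
  simp

end aux12


/-- Let q be a prime power, let C_b ⊆ F_q^n be a linear code and ℓ ≥ 1.
For the ℓ-layer ensemble of codes C(π1,c1,…,πℓ,cℓ) = {x : φ_{πi,ci}(x) ∈ C_b for all i},
indexed by all (n!·(q−1)^n)^ℓ tuples, the average over all tuples of the number of weight-W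
codewords equals A(W)^ℓ / ((q−1)^W · binom(n,W))^{ℓ−1}, where A(W) = #{y ∈ C_b : wt(y) = W}. -/
theorem statement_12 (q n ℓ : ℕ) (hq : IsPrimePow q) (hℓ : 1 ≤ ℓ)
    (F : Type) [Field F] [Fintype F] [DecidableEq F] (hF : Fintype.card F = q)
    (Cb : Submodule F (Fin n → F))
    (W : ℕ) (hW : W ≤ n)
    (A : ℕ) (hA : A = Nat.card {y : Fin n → F // y ∈ Cb ∧ hammingNorm y = W}) :
    (∑ t : Fin ℓ → Equiv.Perm (Fin n) × {c : Fin n → F // ∀ j, c j ≠ 0},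
        (Nat.card {x : Fin n → F //
            (∀ i : Fin ℓ, (fun j => ((t i).2 : Fin n → F) j * x ((t i).1 j)) ∈ Cb) ∧
            hammingNorm x = W} : ℚ))
      / ((n.factorial : ℚ) * ((q : ℚ) - 1) ^ n) ^ ℓ
    = (A : ℚ) ^ ℓ / (((q : ℚ) - 1) ^ W * (n.choose W : ℚ)) ^ (ℓ - 1) := by
  classical
  have hq1 : 1 < q := hq.one_lt
  have h0 := tuples12 (F := F) (n := n) (fun y => y ∈ Cb) W ℓ
  have h0' := congrArg (Nat.cast : ℕ → ℚ) h0
  rw [Nat.cast_sum] at h0'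
  have hd := double12 (F := F) (n := n) (fun y => y ∈ Cb) W
  have hA' : (Finset.univ.filter (fun y : Fin n → F => y ∈ Cb ∧ hammingNorm y = W)).card = A := by
    rw [hA, Nat.card_eq_fintype_card, Fintype.card_subtype]
  rw [hA', cardT12, hF] at hd
  have hS := cardS12 (F := F) (n := n) W
  rw [hF] at hS
  have hNpos : 0 < (q - 1) ^ W * n.choose W :=
    Nat.mul_pos (pow_pos (by omega) _) (Nat.choose_pos hW)
  obtain ⟨x₀, hx₀⟩ := Finset.card_pos.1 (hS ▸ hNpos)
  have hx₀' : hammingNorm x₀ = W := by simpa using hx₀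
  set g := (Finset.univ.filter (fun t : TT12 n F => phi12 t x₀ ∈ Cb)).card with hg
  have hgx : ∀ x ∈ Finset.univ.filter (fun x : Fin n → F => hammingNorm x = W),
      (Finset.univ.filter (fun t : TT12 n F => phi12 t x ∈ Cb)).card = g := by
    intro x hx
    refine g_eq12 (fun y => y ∈ Cb) x x₀ ?_
    rw [hx₀']; simpa using hx
  rw [Finset.sum_congr rfl hgx, Finset.sum_const, hS, smul_eq_mul] at hd
  have hsum : ∑ x ∈ Finset.univ.filter (fun x : Fin n → F => hammingNorm x = W),
      (Finset.univ.filter (fun t : TT12 n F => phi12 t x ∈ Cb)).card ^ ℓ =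
      (q - 1) ^ W * n.choose W * g ^ ℓ := by
    rw [Finset.sum_congr rfl (fun x hx => congrArg (fun z => z ^ ℓ) (hgx x hx)),
      Finset.sum_const, hS, smul_eq_mul]
  rw [hsum] at h0'
  have hcast : ((q - 1 : ℕ) : ℚ) = (q : ℚ) - 1 := by
    rw [Nat.cast_sub hq1.le, Nat.cast_one]
  have hd' := congrArg (Nat.cast : ℕ → ℚ) hd
  push_cast [hcast] at hd' h0'
  refine (congrArg (fun z : ℚ => z / ((n.factorial : ℚ) * ((q : ℚ) - 1) ^ n) ^ ℓ) h0').trans ?_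
  have hqp : (0 : ℚ) < (q : ℚ) - 1 := by
    have : (1 : ℚ) < q := by exact_mod_cast hq1
    linarith
  have hN : (0 : ℚ) < ((q : ℚ) - 1) ^ W * (n.choose W : ℚ) :=
    mul_pos (pow_pos hqp _) (by exact_mod_cast Nat.choose_pos hW)
  have hT : (0 : ℚ) < (n.factorial : ℚ) * ((q : ℚ) - 1) ^ n :=
    mul_pos (by exact_mod_cast n.factorial_pos) (pow_pos hqp _)
  obtain ⟨k, rfl⟩ : ∃ k, ℓ = k + 1 := ⟨ℓ - 1, by omega⟩
  generalize ((q : ℚ) - 1) ^ W * (n.choose W : ℚ) = N at *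
  generalize (n.factorial : ℚ) * ((q : ℚ) - 1) ^ n = T at *
  rw [Nat.add_sub_cancel, div_eq_div_iff (by positivity) (by positivity), ← mul_pow, mul_comm (A : ℚ),
    ← hd']
  ring
end
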